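/- arXiv:1906.00385 — 2 statements merged into one kernel-verified Lean document; each statement's English description precedes it below -/
import Mathlib

section
/- For every simple weight 𝕀_1-module M one has End_{𝕀_1}(M) ≅ K; explicitly, End_{𝕀_1}(K[x]) ≅ K and End_{𝕀_1}(M(1,λ)) ≅ K for every λ ∈ K. -/
set_option maxHeartbeats 1000000
set_option synthInstance.maxHeartbeats 400000
set_option linter.unusedSectionVars false

namespace IDO

open scoped TensorProduct

noncomputable section

variable (K : Type*) [Field K] [CharZero K] (n : ℕ)

/-- The polynomial algebra `P_n = K[x_1, …, x_n]`. -/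
abbrev P := MvPolynomial (Fin n) K

/-- The multiplication operator `x_i`. -/
def xOp (i : Fin n) : Module.End K (P K n) := LinearMap.mulLeft K (MvPolynomial.X i)

/-- The partial derivative `∂_i`. -/
def dOp (i : Fin n) : Module.End K (P K n) := (MvPolynomial.pderiv i).toLinearMap

/-- The integration operator `∫_i`, sending `x^α ↦ x^{α+e_i}/(α_i+1)`. -/
def intOp (i : Fin n) : Module.End K (P K n) :=
  ((MvPolynomial.basisMonomials (Fin n) K).constr K)
    (fun α => (((α i : ℕ) : K) + 1)⁻¹ •
      (MvPolynomial.monomial (α + Finsupp.single i 1) (1 : K)))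

/-- The algebra of polynomial integro-differential operators `𝕀_n`, as a subalgebra of
`End_K(P_n)` generated by the `x_i`, `∂_i` and `∫_i`. -/
def InSub : Subalgebra K (Module.End K (P K n)) :=
  Algebra.adjoin K (Set.range (xOp K n) ∪ Set.range (dOp K n) ∪ Set.range (intOp K n))

/-- The algebra `𝕀_n` (as a type, with its canonical ring structure). -/
def In : Type _ := InSub K n

instance : Ring (In K n) := inferInstanceAs (Ring (InSub K n))
instance : Algebra K (In K n) := inferInstanceAs (Algebra K (InSub K n))
instance : Module (In K n) (P K n) := inferInstanceAs (Module (InSub K n) (P K n))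
instance : IsScalarTower K (In K n) (P K n) :=
  inferInstanceAs (IsScalarTower K (InSub K n) (P K n))

/-- `x_i` as an element of `𝕀_n`. -/
def xEl (i : Fin n) : In K n :=
  show InSub K n from
    ⟨xOp K n i, Algebra.subset_adjoin (Set.mem_union_left _ (Set.mem_union_left _ ⟨i, rfl⟩))⟩

/-- `∂_i` as an element of `𝕀_n`. -/
def dEl (i : Fin n) : In K n :=
  show InSub K n from
    ⟨dOp K n i, Algebra.subset_adjoin (Set.mem_union_left _ (Set.mem_union_right _ ⟨i, rfl⟩))⟩

/-- `∫_i` as an element of `𝕀_n`. -/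
def intEl (i : Fin n) : In K n :=
  show InSub K n from
    ⟨intOp K n i, Algebra.subset_adjoin (Set.mem_union_right _ ⟨i, rfl⟩)⟩

/-- `H_i = ∂_i x_i` as an element of `𝕀_n`. -/
def HEl (i : Fin n) : In K n := dEl K n i * xEl K n i

section Modules

variable (M : Type*) [AddCommGroup M] [Module K M] [Module (In K n) M]
  [IsScalarTower K (In K n) M]

/-- The weight space `M_λ = {m | H_i m = λ_i m for all i}`. -/
def weightSpace (lam : Fin n → K) : Submodule K M where
  carrier := {m | ∀ i, HEl K n i • m = lam i • m}
  add_mem' := by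
    intro a b ha hb i
    rw [smul_add, ha i, hb i, smul_add]
  zero_mem' := by intro i; simp
  smul_mem' := by
    intro c m hm i
    rw [← smul_comm c (HEl K n i) m, hm i, smul_smul, mul_comm, ← smul_smul]

private lemma pow_smul_zero_mono {a : In K n} {m : M} {s s' : ℕ}
    (h : (a ^ s) • m = 0) (hle : s ≤ s') : (a ^ s') • m = 0 := by
  obtain ⟨k, rfl⟩ := Nat.exists_eq_add_of_le hle
  rw [add_comm s k, pow_add, mul_smul, h, smul_zero]

/-- The generalized weight space `M^λ = {m | (H_i − λ_i)^N m = 0 for some N and all i}`. -/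
def genWeightSpace (lam : Fin n → K) : Submodule K M where
  carrier := {m | ∃ N : ℕ, ∀ i,
    ((HEl K n i - algebraMap K (In K n) (lam i)) ^ N) • m = 0}
  add_mem' := by
    rintro a b ⟨Na, ha⟩ ⟨Nb, hb⟩
    refine ⟨Na ⊔ Nb, fun i => ?_⟩
    rw [smul_add, pow_smul_zero_mono K n M (ha i) le_sup_left,
      pow_smul_zero_mono K n M (hb i) le_sup_right, add_zero]
  zero_mem' := ⟨0, fun i => smul_zero _⟩
  smul_mem' := by
    rintro c m ⟨N, hN⟩
    exact ⟨N, fun i => by rw [← smul_comm c _ m, hN i, smul_zero]⟩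

/-- `M` is a weight module: `M = ⊕_λ M_λ`. -/
def IsWeightModule : Prop :=
  letI := Classical.decEq (Fin n → K)
  DirectSum.IsInternal (fun lam : Fin n → K => weightSpace K n M lam)

/-- `M` is a generalized weight module: `M = ⊕_λ M^λ`. -/
def IsGenWeightModule : Prop :=
  letI := Classical.decEq (Fin n → K)
  DirectSum.IsInternal (fun lam : Fin n → K => genWeightSpace K n M lam)

/-- The support `Supp(M) = {λ | M^λ ≠ 0}`. -/
def supp : Set (Fin n → K) := {lam | genWeightSpace K n M lam ≠ ⊥}

/-- `M` is an indecomposable `𝕀_n`-module. -/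
def IsIndecomposableMod : Prop :=
  Nontrivial M ∧ ∀ p q : Submodule (In K n) M, IsCompl p q → p = ⊥ ∨ q = ⊥

/-- The annihilator of an `𝕀_n`-module, as a set. -/
def annSet : Set (In K n) := {a | ∀ m : M, a • m = 0}

end Modules

/-- A prime (two-sided) ideal of the noncommutative ring `𝕀_n`, given as a set:
`S ≠ 𝕀_n` and `a 𝕀_n b ⊆ S → a ∈ S ∨ b ∈ S`. -/
def IsPrimeSet (S : Set (In K n)) : Prop :=
  S ≠ Set.univ ∧ ∀ a b : In K n, (∀ r : In K n, a * r * b ∈ S) → a ∈ S ∨ b ∈ S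

-- orbits
/-- The `ℤ^n`-orbit of `λ ∈ K^n`. -/
def orbitOf (lam : Fin n → K) : Set (Fin n → K) :=
  {mu | ∀ i, ∃ z : ℤ, mu i - lam i = (z : K)}

/-- The setoid on `K^n` whose classes are the `ℤ^n`-orbits. -/
def orbitSetoid : Setoid (Fin n → K) where
  r mu nu := ∀ i, ∃ z : ℤ, mu i - nu i = (z : K)
  iseqv := by
    constructor
    · intro x i; exact ⟨0, by simp⟩
    · intro x y h i
      obtain ⟨z, hz⟩ := h i
      exact ⟨-z, by push_cast; linear_combination -hz⟩
    · intro x y z hxy hyz i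
      obtain ⟨a, ha⟩ := hxy i
      obtain ⟨b, hb⟩ := hyz i
      exact ⟨a + b, by push_cast; linear_combination ha + hb⟩

/-- `𝔻_Ω = {i | Ω_i = ℤ}` for the orbit `Ω` of `λ`. -/
def DD (lam : Fin n → K) : Set (Fin n) := {i | ∃ z : ℤ, lam i = (z : K)}

/-- `λ` is the normalized representative of its orbit: integer coordinates are `0`. -/
def IsNormalized (lam : Fin n → K) : Prop := ∀ i, (∃ z : ℤ, lam i = (z : K)) → lam i = 0


-- I_1 specifics
/-- The matrix units `e_{st} = ∫^s ∂^t − ∫^{s+1} ∂^{t+1}` of `𝕀_1`. -/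
def eEl1 (s t : ℕ) : In K 1 :=
  intEl K 1 0 ^ s * dEl K 1 0 ^ t - intEl K 1 0 ^ (s + 1) * dEl K 1 0 ^ (t + 1)

/-- `F = ⊕ K e_{st}`, the unique proper two-sided ideal of `𝕀_1`, here as the left ideal
generated by the `e_{st}` (the two coincide). -/
def Fideal : Submodule (In K 1) (In K 1) :=
  Submodule.span (In K 1) {a | ∃ s t : ℕ, a = eEl1 K s t}

/-- The left ideal `F + 𝕀_1 (H − μ)^s`. -/
def MslIdeal (s : ℕ) (mu : K) : Submodule (In K 1) (In K 1) :=
  Fideal K ⊔ Submodule.span (In K 1) {(HEl K 1 0 - algebraMap K (In K 1) mu) ^ s}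

/-- The `𝕀_1`-module `M(s,μ) = 𝕀_1/(F + 𝕀_1 (H − μ)^s)`. -/
def Msl (s : ℕ) (mu : K) := (In K 1) ⧸ MslIdeal K s mu

instance (s : ℕ) (mu : K) : AddCommGroup (Msl K s mu) :=
  inferInstanceAs (AddCommGroup ((In K 1) ⧸ MslIdeal K s mu))
instance (s : ℕ) (mu : K) : Module (In K 1) (Msl K s mu) :=
  inferInstanceAs (Module (In K 1) ((In K 1) ⧸ MslIdeal K s mu))
instance (s : ℕ) (mu : K) : Module K (Msl K s mu) :=
  inferInstanceAs (Module K ((In K 1) ⧸ MslIdeal K s mu))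
instance (s : ℕ) (mu : K) : IsScalarTower K (In K 1) (Msl K s mu) :=
  inferInstanceAs (IsScalarTower K (In K 1) ((In K 1) ⧸ MslIdeal K s mu))

-- two-sided ideals of I_n
/-- The element `e_{st}(i) ∈ 𝕀_n` built from the `i`-th tensor factor. -/
def eElN (i : Fin n) (s t : ℕ) : In K n :=
  intEl K n i ^ s * dEl K n i ^ t - intEl K n i ^ (s + 1) * dEl K n i ^ (t + 1)

/-- The height one prime `𝔭_i`, the two-sided ideal of `𝕀_n` generated by `F(i)`. -/
def pIdeal (i : Fin n) : TwoSidedIdeal (In K n) :=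
  TwoSidedIdeal.span {a | ∃ s t : ℕ, a = eElN K n i s t}

/-- `𝔞_n(I) = Σ_{i ∈ I} 𝔭_i`. -/
def aIdeal (I : Set (Fin n)) : TwoSidedIdeal (In K n) := ⨆ i ∈ I, pIdeal K n i


-- bundled modules
universe u

/-- A bundled `𝕀_n`-module (with compatible `K`-structure). -/
structure ModN (K : Type u) [Field K] [CharZero K] (n : ℕ) : Type (u + 1) where
  carrier : Type u
  [instAdd : AddCommGroup carrier]
  [instK : Module K carrier]
  [instIn : Module (In K n) carrier]
  [instTower : IsScalarTower K (In K n) carrier]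

attribute [instance] ModN.instAdd ModN.instK ModN.instIn ModN.instTower

/-- The endomorphism of `M_1 ⊗ ⋯ ⊗ M_n` acting by `a ∈ 𝕀_1` on the `i`-th factor. -/
def tprodMap (Mi : Fin n → ModN K 1) (i : Fin n) (a : In K 1) :
    (⨂[K] j, (Mi j).carrier) →ₗ[K] ⨂[K] j, (Mi j).carrier :=
  PiTensorProduct.map (Function.update
    (fun j => (LinearMap.id : (Mi j).carrier →ₗ[K] (Mi j).carrier)) i
    (DistribMulAction.toLinearMap K ((Mi i).carrier) a))

/-- The `𝕀_n`-module `M` "is" the tensor product `M_1 ⊗ ⋯ ⊗ M_n` of the `𝕀_1`-modules `M_i`: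
there is a `K`-linear isomorphism under which the generators `x_i, ∂_i, ∫_i` of `𝕀_n` act on
the `i`-th tensor factor via the corresponding generators of `𝕀_1`. -/
def RealizesTensor (Mi : Fin n → ModN K 1) (M : Type*) [AddCommGroup M] [Module K M]
    [Module (In K n) M] [IsScalarTower K (In K n) M] : Prop :=
  ∃ φ : M ≃ₗ[K] ⨂[K] j, (Mi j).carrier,
    ∀ (i : Fin n) (m : M),
      φ (xEl K n i • m) = tprodMap K n Mi i (xEl K 1 0) (φ m) ∧
      φ (dEl K n i • m) = tprodMap K n Mi i (dEl K 1 0) (φ m) ∧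
      φ (intEl K n i • m) = tprodMap K n Mi i (intEl K 1 0) (φ m)

/-- `M` is (isomorphic to) the simple weight module `M(𝒟_Ω)` attached to the orbit of `λ`
and the subset `𝒟 ⊆ 𝔻_Ω`: the tensor product of copies of `K[x]` (for `i ∈ 𝒟`) and of
`M(1, λ_i)` (for `i ∉ 𝒟`). -/
def RealizesMD (lam : Fin n → K) (D : Set (Fin n)) (M : Type*) [AddCommGroup M] [Module K M]
    [Module (In K n) M] [IsScalarTower K (In K n) M] : Prop :=
  ∃ Mi : Fin n → ModN K 1,
    (∀ i, i ∈ D → Nonempty ((Mi i).carrier ≃ₗ[In K 1] P K 1)) ∧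
    (∀ i, i ∉ D → Nonempty ((Mi i).carrier ≃ₗ[In K 1] Msl K 1 (lam i))) ∧
    RealizesTensor K n Mi M

/-- `M` is (isomorphic to) the module `P_{n-1} ⊗ M(s, λ)` (with the copy of `M(s,λ)` placed
in position `j`). -/
def RealizesPMs (lam : Fin n → K) (j : Fin n) (s : ℕ) (M : Type*) [AddCommGroup M] [Module K M]
    [Module (In K n) M] [IsScalarTower K (In K n) M] : Prop :=
  ∃ Mi : Fin n → ModN K 1,
    (∀ i, i ≠ j → Nonempty ((Mi i).carrier ≃ₗ[In K 1] P K 1)) ∧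
    Nonempty ((Mi j).carrier ≃ₗ[In K 1] Msl K s (lam j)) ∧
    RealizesTensor K n Mi M

/-- Membership in the category `GW(𝕀_n, 𝒟_Ω)`: generalized weight modules with support in the
orbit of `λ` all of whose simple subquotients are isomorphic to `M(𝒟_Ω)`. -/
def InGWD (lam : Fin n → K) (D : Set (Fin n)) (M : Type*) [AddCommGroup M] [Module K M]
    [Module (In K n) M] [IsScalarTower K (In K n) M] : Prop :=
  IsGenWeightModule K n M ∧ supp K n M ⊆ orbitOf K n lam ∧
  ∀ (p q : Submodule (In K n) M), p ≤ q →
    IsSimpleModule (In K n) (q ⧸ Submodule.comap q.subtype p) →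
    RealizesMD K n lam D (q ⧸ Submodule.comap q.subtype p)

/-- The support `S(𝒟_Ω) = ℕ_+^{𝒟_Ω} × ∏_{i ∉ 𝒟_Ω} (λ_i + ℤ)` of the module `M(𝒟_Ω)`. -/
def SuppMD (lam : Fin n → K) (D : Set (Fin n)) : Set (Fin n → K) :=
  {mu | (∀ i ∈ D, ∃ m : ℕ, 0 < m ∧ mu i = (m : K)) ∧
        (∀ i ∉ D, ∃ z : ℤ, mu i = lam i + (z : K))}

/-- `M` is an absolutely prime `𝕀_n`-module: its annihilator is a prime ideal and every
nonzero subfactor of `M` has the same annihilator. -/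
def IsAbsolutelyPrime (M : Type*) [AddCommGroup M] [Module K M]
    [Module (In K n) M] [IsScalarTower K (In K n) M] : Prop :=
  IsPrimeSet K n (annSet K n M) ∧
  ∀ (p q : Submodule (In K n) M), p ≤ q →
    Nontrivial (q ⧸ Submodule.comap q.subtype p) →
    annSet K n (q ⧸ Submodule.comap q.subtype p) = annSet K n M


-- the commutative subalgebra D_n = K[H_1, …, H_n]
lemma xEl_smul (i : Fin n) (p : P K n) : xEl K n i • p = MvPolynomial.X i * p := rfl

lemma dEl_smul (i : Fin n) (p : P K n) : dEl K n i • p = MvPolynomial.pderiv i p := rfl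

lemma hEl_monomial (i : Fin n) (α : Fin n →₀ ℕ) (c : K) :
    HEl K n i • (MvPolynomial.monomial α c : P K n)
      = (((α i : ℕ) : K) + 1) • MvPolynomial.monomial α c := by
  have hx : xEl K n i • (MvPolynomial.monomial α c : P K n)
      = MvPolynomial.monomial (α + Finsupp.single i 1) c := by
    rw [xEl_smul, MvPolynomial.X, MvPolynomial.monomial_mul, one_mul, add_comm]
  rw [HEl, mul_smul, hx, dEl_smul, MvPolynomial.pderiv_monomial,
    add_tsub_cancel_right, MvPolynomial.smul_monomial, Finsupp.add_apply,
    Finsupp.single_eq_same, smul_eq_mul]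
  congr 1
  push_cast
  ring

private lemma In_ext {a b : In K n} (h : ∀ p : P K n, a • p = b • p) : a = b := by
  have : (show InSub K n from a) = (show InSub K n from b) :=
    Subtype.ext (LinearMap.ext fun p => h p)
  exact this

lemma hEl_comm (i j : Fin n) : HEl K n i * HEl K n j = HEl K n j * HEl K n i := by
  apply In_ext
  intro p
  induction p using MvPolynomial.induction_on' with
  | monomial α c =>
      have key : ∀ a b : Fin n, (HEl K n a * HEl K n b) • (MvPolynomial.monomial α c : P K n)
          = ((((α b : ℕ) : K) + 1) * (((α a : ℕ) : K) + 1)) • MvPolynomial.monomial α c := by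
        intro a b
        rw [mul_smul, hEl_monomial, ← smul_comm, hEl_monomial, smul_smul]
      rw [key, key, mul_comm]
  | add p q hp hq =>
      rw [smul_add, smul_add, hp, hq]

/-- `D_n = K[H_1, …, H_n]` as a subalgebra of `𝕀_n`. -/
def DnSub : Subalgebra K (In K n) := Algebra.adjoin K (Set.range (HEl K n))

/-- The commutative algebra `D_n` (as a type). -/
def Dn : Type _ := DnSub K n

instance : CommRing (Dn K n) :=
  Algebra.adjoinCommRingOfComm K (by rintro a ⟨i, rfl⟩ b ⟨j, rfl⟩; exact hEl_comm K n i j)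

instance : Algebra K (Dn K n) := inferInstanceAs (Algebra K (DnSub K n))

/-- The inclusion `D_n → 𝕀_n`. -/
def dnVal : Dn K n →+* In K n := ((DnSub K n).val : DnSub K n →ₐ[K] In K n).toRingHom

/-- `H_i` as an element of `D_n`. -/
def HElD (i : Fin n) : Dn K n :=
  show DnSub K n from ⟨HEl K n i, Algebra.subset_adjoin ⟨i, rfl⟩⟩

lemma dn_comm (d : Dn K n) (i : Fin n) :
    dnVal K n d * HEl K n i = HEl K n i * dnVal K n d := by
  have h1 : DnSub K n ≤ Subalgebra.centralizer K (Set.range (HEl K n)) := by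
    apply Algebra.adjoin_le
    rintro x ⟨j, rfl⟩
    rw [SetLike.mem_coe, Subalgebra.mem_centralizer_iff]
    rintro g ⟨i', rfl⟩
    exact hEl_comm K n i' j
  have h2 := (Subalgebra.mem_centralizer_iff K).mp
    (h1 (show DnSub K n from d).2) (HEl K n i) ⟨i, rfl⟩
  exact h2.symm


section DnModules

variable (M : Type*) [AddCommGroup M] [Module K M] [Module (In K n) M]
  [IsScalarTower K (In K n) M]

lemma genWS_stable (lam : Fin n → K) {m : M} (hm : m ∈ genWeightSpace K n M lam)
    (d : Dn K n) : dnVal K n d • m ∈ genWeightSpace K n M lam := by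
  obtain ⟨N, hN⟩ := hm
  refine ⟨N, fun i => ?_⟩
  have hc : Commute (dnVal K n d) ((HEl K n i - algebraMap K (In K n) (lam i)) ^ N) := by
    apply Commute.pow_right
    exact Commute.sub_right (dn_comm K n d i) ((Algebra.commutes (lam i) (dnVal K n d)).symm)
  rw [← mul_smul, ← hc.eq, mul_smul, hN i, smul_zero]

instance genWS_smul (lam : Fin n → K) : SMul (Dn K n) (genWeightSpace K n M lam) :=
  ⟨fun d w => ⟨dnVal K n d • (w : M), genWS_stable K n M lam w.2 d⟩⟩

instance genWS_module (lam : Fin n → K) : Module (Dn K n) (genWeightSpace K n M lam) :=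
  Module.ofMinimalAxioms
    (fun d x y => Subtype.ext (smul_add (dnVal K n d) (x : M) (y : M)))
    (fun d d' x => Subtype.ext (show dnVal K n (d + d') • (x : M)
      = dnVal K n d • (x : M) + dnVal K n d' • (x : M) by rw [map_add, add_smul]))
    (fun d d' x => Subtype.ext (show dnVal K n (d * d') • (x : M)
      = dnVal K n d • (dnVal K n d' • (x : M)) by rw [map_mul, mul_smul]))
    (fun x => Subtype.ext (show dnVal K n 1 • (x : M) = (x : M) by rw [map_one, one_smul]))

instance genWS_tower (lam : Fin n → K) :
    IsScalarTower K (Dn K n) (genWeightSpace K n M lam) :=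
  ⟨fun c d w => Subtype.ext (show dnVal K n (c • d) • (w : M) = c • (dnVal K n d • (w : M)) by
    rw [show dnVal K n (c • d) = c • dnVal K n d from map_smul (DnSub K n).val c d, smul_assoc])⟩

end DnModules

/-- The maximal ideal `𝔪_λ = (H_1 − λ_1, …, H_n − λ_n)` of `D_n`. -/
def mIdeal (lam : Fin n → K) : Ideal (Dn K n) :=
  Ideal.span {d | ∃ i, d = HElD K n i - algebraMap K (Dn K n) (lam i)}

/-- The category `LF_𝔪(D_n)` of `𝔪_λ`-locally finite `D_n`-modules: every cyclic submodule is
finite dimensional over `K` and annihilated by a power of `𝔪_λ`. -/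
def IsLF (lam : Fin n → K) (N : Type*) [AddCommGroup N] [Module K N] [Module (Dn K n) N]
    [IsScalarTower K (Dn K n) N] : Prop :=
  ∀ x : N, FiniteDimensional K ((Submodule.span (Dn K n) {x}).restrictScalars K) ∧
    ∃ s : ℕ, ∀ i, ((HElD K n i - algebraMap K (Dn K n) (lam i)) ^ s) • x = 0

-- the algebra B_n = 𝕀_n/𝔞_n
/-- The maximal ideal `𝔞_n = 𝔭_1 + ⋯ + 𝔭_n` of `𝕀_n`. -/
def aFull : TwoSidedIdeal (In K n) := aIdeal K n Set.univ

/-- The skew Laurent polynomial algebra `B_n = 𝕀_n/𝔞_n`. -/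
def Bn : Type _ := (aFull K n).ringCon.Quotient

instance : Ring (Bn K n) := inferInstanceAs (Ring (aFull K n).ringCon.Quotient)

/-- The quotient map `𝕀_n → B_n`. -/
def toBn : In K n →+* Bn K n := RingCon.mk' _

lemma toBn_surjective : Function.Surjective (toBn K n) :=
  Quotient.mk''_surjective

/-- The composite `D_n → 𝕀_n → B_n`. -/
def bnD : Dn K n →+* Bn K n := (toBn K n).comp (dnVal K n)

/-- `B_n` as a right `D_n`-module (written as a left module structure, `d • b = b ⬝ d`). -/
instance : SMul (Dn K n) (Bn K n) := ⟨fun d b => b * bnD K n d⟩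

instance : Module (Dn K n) (Bn K n) :=
  Module.ofMinimalAxioms
    (fun d x y => show (x + y) * bnD K n d = x * bnD K n d + y * bnD K n d from add_mul _ _ _)
    (fun d d' x => show x * bnD K n (d + d') = x * bnD K n d + x * bnD K n d' by
      rw [map_add, mul_add])
    (fun d d' x => show x * bnD K n (d * d') = (x * bnD K n d') * bnD K n d by
      rw [mul_comm d d', map_mul, ← mul_assoc])
    (fun x => show x * bnD K n 1 = x by rw [map_one, mul_one])

instance : SMulCommClass (Dn K n) (Bn K n) (Bn K n) :=
  ⟨fun d b m => show (b * m) * bnD K n d = b * (m * bnD K n d) from mul_assoc b m (bnD K n d)⟩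

/-- The induced module `B_n ⊗_{D_n} N` of a `D_n`-module `N`. -/
def Ind (N : Type*) [AddCommGroup N] [Module (Dn K n) N] : Type _ :=
  (Bn K n) ⊗[Dn K n] N

section Ind

variable (N : Type*) [AddCommGroup N] [Module (Dn K n) N]

instance : AddCommGroup (Ind K n N) :=
  inferInstanceAs (AddCommGroup ((Bn K n) ⊗[Dn K n] N))

instance indModuleBn : Module (Bn K n) (Ind K n N) :=
  inferInstanceAs (Module (Bn K n) ((Bn K n) ⊗[Dn K n] N))

instance indModuleDn : Module (Dn K n) (Ind K n N) :=
  inferInstanceAs (Module (Dn K n) ((Bn K n) ⊗[Dn K n] N))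

instance indModuleIn : Module (In K n) (Ind K n N) := Module.compHom _ (toBn K n)

instance indModuleK : Module K (Ind K n N) := Module.compHom _ (algebraMap K (Dn K n))

lemma bn_algebraMap_comm (c : K) (u : Bn K n) :
    toBn K n (algebraMap K (In K n) c) * u = u * toBn K n (algebraMap K (In K n) c) := by
  obtain ⟨r, rfl⟩ := toBn_surjective K n u
  rw [← map_mul, ← map_mul, Algebra.commutes]

lemma dnVal_algebraMap (c : K) :
    dnVal K n (algebraMap K (Dn K n) c) = algebraMap K (In K n) c :=
  AlgHom.commutes (DnSub K n).val c

lemma ind_key (c : K) (w : (Bn K n) ⊗[Dn K n] N) :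
    (toBn K n (algebraMap K (In K n) c)) • w = (algebraMap K (Dn K n) c) • w := by
  induction w using TensorProduct.induction_on with
  | zero => rw [smul_zero, smul_zero]
  | tmul b x =>
      rw [TensorProduct.smul_tmul', TensorProduct.smul_tmul']
      congr 1
      show toBn K n (algebraMap K (In K n) c) * b = b * bnD K n (algebraMap K (Dn K n) c)
      have h1 : bnD K n (algebraMap K (Dn K n) c) = toBn K n (algebraMap K (In K n) c) := by
        show toBn K n (dnVal K n (algebraMap K (Dn K n) c)) = _
        rw [dnVal_algebraMap]
      rw [h1, bn_algebraMap_comm]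
  | add x y hx hy => rw [smul_add, smul_add, hx, hy]

instance indTower : IsScalarTower K (In K n) (Ind K n N) := by
  constructor
  intro c a v
  show toBn K n (c • a) • v = algebraMap K (Dn K n) c • ((toBn K n a : Bn K n) • v)
  rw [Algebra.smul_def, map_mul, mul_smul]
  exact ind_key K n N c _

end Ind


section BnQuot

variable (J : Submodule (Bn K n) (Bn K n))

instance : Module (In K n) (Bn K n ⧸ J) := Module.compHom _ (toBn K n)

instance : Module K (Bn K n ⧸ J) :=
  Module.compHom _ ((toBn K n).comp (algebraMap K (In K n)))

instance : IsScalarTower K (In K n) (Bn K n ⧸ J) := by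
  constructor
  intro c a v
  show toBn K n (c • a) • v = (toBn K n (algebraMap K (In K n) c)) • (toBn K n a • v)
  rw [Algebra.smul_def, map_mul, mul_smul]

end BnQuot

/-- The `𝕀_n`-module `M` "is" the tensor product `A ⊗ B` of an `𝕀_m`-module `A` and an
`𝕀_{n-m}`-module `B`: there is a `K`-linear isomorphism under which the generators of `𝕀_n`
with index `< m` act on the first factor (via the corresponding generators of `𝕀_m`) and the
remaining generators act on the second factor (via the generators of `𝕀_{n-m}`). -/
def RealizesSplit (m : ℕ) (A : Type*) [AddCommGroup A] [Module K A] [Module (In K m) A]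
    [IsScalarTower K (In K m) A]
    (B : Type*) [AddCommGroup B] [Module K B] [Module (In K (n - m)) B]
    [IsScalarTower K (In K (n - m)) B]
    (M : Type*) [AddCommGroup M] [Module K M] [Module (In K n) M]
    [IsScalarTower K (In K n) M] : Prop :=
  ∃ φ : M ≃ₗ[K] A ⊗[K] B,
    (∀ (i : Fin n) (hi : (i : ℕ) < m) (v : M),
      φ (xEl K n i • v) = LinearMap.rTensor B
        (DistribMulAction.toLinearMap K A (xEl K m ⟨i, hi⟩)) (φ v) ∧
      φ (dEl K n i • v) = LinearMap.rTensor B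
        (DistribMulAction.toLinearMap K A (dEl K m ⟨i, hi⟩)) (φ v) ∧
      φ (intEl K n i • v) = LinearMap.rTensor B
        (DistribMulAction.toLinearMap K A (intEl K m ⟨i, hi⟩)) (φ v)) ∧
    (∀ (i : Fin n) (hi : m ≤ (i : ℕ)) (v : M),
      φ (xEl K n i • v) = LinearMap.lTensor A
        (DistribMulAction.toLinearMap K B (xEl K (n - m) ⟨(i : ℕ) - m, by omega⟩)) (φ v) ∧
      φ (dEl K n i • v) = LinearMap.lTensor A
        (DistribMulAction.toLinearMap K B (dEl K (n - m) ⟨(i : ℕ) - m, by omega⟩)) (φ v) ∧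
      φ (intEl K n i • v) = LinearMap.lTensor A
        (DistribMulAction.toLinearMap K B (intEl K (n - m) ⟨(i : ℕ) - m, by omega⟩)) (φ v))

end


section Helpers

open MvPolynomial

variable (K : Type*) [Field K] [CharZero K]

lemma hp_int_monomial (α : Fin 1 →₀ ℕ) (c : K) :
    intEl K 1 0 • (monomial α c : P K 1)
      = monomial (α + Finsupp.single 0 1) ((((α 0 : ℕ) : K) + 1)⁻¹ * c) := by
  have h1 : intEl K 1 0 • (monomial α (1:K) : P K 1)
      = (((α 0 : ℕ) : K) + 1)⁻¹ • (monomial (α + Finsupp.single 0 1) (1 : K)) := by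
    show intOp K 1 0 (monomial α (1:K)) = _
    unfold intOp
    have := (MvPolynomial.basisMonomials (Fin 1) K).constr_basis K (fun α => (((α 0 : ℕ) : K) + 1)⁻¹ •
      (MvPolynomial.monomial (α + Finsupp.single 0 1) (1 : K))) α
    simpa using this
  have h2 : (monomial α c : P K 1) = c • monomial α 1 := by
    rw [smul_monomial, smul_eq_mul, mul_one]
  rw [h2, ← smul_comm, h1, smul_smul, smul_monomial]
  congr 1
  simp [mul_comm]

lemma hp_d_monomial_succ (α : Fin 1 →₀ ℕ) (c : K) :
    dEl K 1 0 • (monomial (α + Finsupp.single 0 1) c : P K 1)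
      = monomial α ((((α 0 : ℕ) : K) + 1) * c) := by
  rw [dEl_smul, pderiv_monomial, add_tsub_cancel_right]
  congr 1
  simp [mul_comm]

lemma hp_d_zero (c : K) : dEl K 1 0 • (monomial 0 c : P K 1) = 0 := by
  rw [dEl_smul, pderiv_monomial]; simp

lemma hp_cases (α : Fin 1 →₀ ℕ) : α = 0 ∨ ∃ β : Fin 1 →₀ ℕ, α = β + Finsupp.single 0 1 := by
  rcases Nat.eq_zero_or_pos (α 0) with h | h
  · left; ext; simpa using h
  · right; refine ⟨Finsupp.single 0 (α 0 - 1), ?_⟩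
    ext; simp; omega

lemma hp_ext {a b : In K 1} (h : ∀ α c, a • (monomial α c : P K 1) = b • monomial α c) :
    a = b := by
  apply In_ext
  intro p
  induction p using MvPolynomial.induction_on' with
  | monomial α c => exact h α c
  | add p q hp hq => rw [smul_add, smul_add, hp, hq]

lemma hp_ne (α : Fin 1 →₀ ℕ) : (((α 0 : ℕ) : K) + 1) ≠ 0 := Nat.cast_add_one_ne_zero (α 0)

lemma hp_R1 : dEl K 1 0 * intEl K 1 0 = 1 := by
  apply hp_ext
  intro α c
  rw [mul_smul, hp_int_monomial, hp_d_monomial_succ, one_smul, mul_inv_cancel_left₀ (hp_ne K α)]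

lemma hp_H (α : Fin 1 →₀ ℕ) (c : K) : HEl K 1 0 • (monomial α c : P K 1)
    = monomial α ((((α 0 : ℕ) : K) + 1) * c) := by
  rw [hEl_monomial, smul_monomial, smul_eq_mul]

lemma hp_R2 : intEl K 1 0 * HEl K 1 0 = xEl K 1 0 := by
  apply hp_ext
  intro α c
  rw [mul_smul, hp_H, hp_int_monomial, inv_mul_cancel_left₀ (hp_ne K α), xEl_smul,
    MvPolynomial.X, MvPolynomial.monomial_mul, one_mul, add_comm]

lemma hp_R3 : dEl K 1 0 * HEl K 1 0 = (HEl K 1 0 + 1) * dEl K 1 0 := by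
  apply hp_ext
  intro α c
  rcases hp_cases α with rfl | ⟨β, rfl⟩
  · rw [mul_smul, mul_smul, hp_H, hp_d_zero, hp_d_zero, smul_zero]
  · rw [mul_smul, mul_smul, hp_H, hp_d_monomial_succ, hp_d_monomial_succ, add_smul, one_smul,
      hp_H, ← map_add]
    congr 1
    simp; ring

lemma hp_R3' : HEl K 1 0 * intEl K 1 0 = intEl K 1 0 * (HEl K 1 0 + 1) := by
  apply hp_ext
  intro α c
  have := hp_ne K α
  rw [mul_smul, mul_smul, add_smul, one_smul, hp_H, ← map_add, hp_int_monomial, hp_int_monomial,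
    hp_H]
  congr 1
  simp; field_simp

lemma hp_R4 : (1 - intEl K 1 0 * dEl K 1 0) * HEl K 1 0 = 1 - intEl K 1 0 * dEl K 1 0 := by
  apply hp_ext
  intro α c
  rcases hp_cases α with rfl | ⟨β, rfl⟩
  · rw [mul_smul, hp_H]; simp
  · rw [mul_smul, hp_H, sub_smul, sub_smul, mul_smul, mul_smul, hp_d_monomial_succ,
      hp_d_monomial_succ, hp_int_monomial, hp_int_monomial, inv_mul_cancel_left₀ (hp_ne K β),
      inv_mul_cancel_left₀ (hp_ne K β)]
    simp

/-- the idempotent `e_00` -/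
noncomputable def hpE : In K 1 := 1 - intEl K 1 0 * dEl K 1 0

lemma hp_d_E : dEl K 1 0 * hpE K = 0 := by
  rw [hpE, mul_sub, ← mul_assoc, hp_R1]; simp

lemma hp_E_int : hpE K * intEl K 1 0 = 0 := by
  rw [hpE, sub_mul, mul_assoc, hp_R1]; simp

lemma hp_E_H : hpE K * HEl K 1 0 = hpE K := hp_R4 K

lemma hp_dk_H (k : ℕ) : dEl K 1 0 ^ k * HEl K 1 0 = (HEl K 1 0 + (k : In K 1)) * dEl K 1 0 ^ k := by
  induction k with
  | zero => simp
  | succ k ih =>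
    rw [pow_succ', mul_assoc, ih, ← mul_assoc, mul_add, hp_R3, ← Nat.cast_comm, ← add_mul,
      mul_assoc]
    push_cast
    rw [add_assoc, add_comm (1 : In K 1)]

lemma hp_H_dk (k : ℕ) : HEl K 1 0 * dEl K 1 0 ^ k
    = dEl K 1 0 ^ k * (HEl K 1 0 - (k : In K 1)) := by
  rw [mul_sub, hp_dk_H, add_mul, ← Nat.cast_comm]; abel

lemma hp_H_intk (k : ℕ) : HEl K 1 0 * intEl K 1 0 ^ k
    = intEl K 1 0 ^ k * (HEl K 1 0 + (k : In K 1)) := by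
  induction k with
  | zero => simp
  | succ k ih =>
    rw [pow_succ, ← mul_assoc, ih, mul_assoc, add_mul, hp_R3', Nat.cast_comm, ← mul_add,
      mul_assoc]
    push_cast
    rw [add_assoc, add_comm (1 : In K 1)]

section Mods

variable {M : Type*} [AddCommGroup M] [Module K M] [Module (In K 1) M]
  [IsScalarTower K (In K 1) M]

lemma hp_stable (W : Submodule K M) (hd : ∀ w ∈ W, dEl K 1 0 • w ∈ W)
    (hi : ∀ w ∈ W, intEl K 1 0 • w ∈ W) (hH : ∀ w ∈ W, HEl K 1 0 • w ∈ W)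
    (a : In K 1) : ∀ w ∈ W, a • w ∈ W := by
  have key : ∀ (a : Module.End K (P K 1)) (ha : a ∈ InSub K 1), ∀ w ∈ W,
      (show In K 1 from (⟨a, ha⟩ : InSub K 1)) • w ∈ W := by
    intro a ha
    induction ha using Algebra.adjoin_induction with
    | mem x hx =>
      intro w hw
      rcases hx with (⟨i, rfl⟩ | ⟨i, rfl⟩) | ⟨i, rfl⟩
      · obtain rfl : i = 0 := Subsingleton.elim _ _
        show xEl K 1 0 • w ∈ W
        rw [← hp_R2, mul_smul]
        exact hi _ (hH _ hw)
      · obtain rfl : i = 0 := Subsingleton.elim _ _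
        exact hd w hw
      · obtain rfl : i = 0 := Subsingleton.elim _ _
        exact hi w hw
    | algebraMap r =>
      intro w hw
      show algebraMap K (In K 1) r • w ∈ W
      rw [algebraMap_smul]
      exact W.smul_mem r hw
    | add x y hx hy h1 h2 =>
      intro w hw
      show ((show In K 1 from (⟨x, hx⟩ : InSub K 1)) + (show In K 1 from (⟨y, hy⟩ : InSub K 1))) • w ∈ W
      rw [add_smul]
      exact W.add_mem (h1 w hw) (h2 w hw)
    | mul x y hx hy h1 h2 =>
      intro w hw
      show ((show In K 1 from (⟨x, hx⟩ : InSub K 1)) * (show In K 1 from (⟨y, hy⟩ : InSub K 1))) • w ∈ W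
      rw [mul_smul]
      exact h1 _ (h2 w hw)
  exact key _ (show InSub K 1 from a).2

lemma hp_top (W : Submodule K M) (hd : ∀ w ∈ W, dEl K 1 0 • w ∈ W)
    (hi : ∀ w ∈ W, intEl K 1 0 • w ∈ W) (hH : ∀ w ∈ W, HEl K 1 0 • w ∈ W)
    (m : M) (hm : m ∈ W) (hg : ∀ w : M, ∃ a : In K 1, a • m = w) (w : M) : w ∈ W := by
  obtain ⟨a, rfl⟩ := hg w
  exact hp_stable K W hd hi hH a m hm

lemma hp_E_mem (U : Submodule K M) (m : M) (hm : ∀ k : ℕ, hpE K • (dEl K 1 0 ^ k) • m ∈ U)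
    (hg : ∀ w : M, ∃ a : In K 1, a • m = w) (w : M) : hpE K • w ∈ U := by
  let W : Submodule K M :=
    { carrier := {w | ∀ k : ℕ, hpE K • (dEl K 1 0 ^ k) • w ∈ U}
      add_mem' := by
        intro a b ha hb k
        rw [smul_add, smul_add]; exact U.add_mem (ha k) (hb k)
      zero_mem' := by intro k; simp
      smul_mem' := by
        intro c x hx k
        rw [← smul_comm c _ x, ← smul_comm c]; exact U.smul_mem c (hx k) }
  have : w ∈ W := by
    refine hp_top K W ?_ ?_ ?_ m hm hg w
    · intro w hw k
      rw [← mul_smul (dEl K 1 0 ^ k), ← pow_succ]; exact hw (k+1)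
    · intro w hw k
      cases k with
      | zero => rw [pow_zero, one_smul, ← mul_smul, hp_E_int, zero_smul]; exact U.zero_mem
      | succ k =>
        rw [← mul_smul (dEl K 1 0 ^ (k+1)), pow_succ, mul_assoc, hp_R1, mul_one]; exact hw k
    · intro w hw k
      rw [← mul_smul (dEl K 1 0 ^ k), hp_dk_H, ← mul_smul, ← mul_assoc, mul_add, hp_E_H,
        ← Nat.cast_comm, add_mul, add_smul, mul_assoc, mul_smul, mul_smul (k : In K 1), mul_smul,
        Nat.cast_smul_eq_nsmul]
      exact U.add_mem (hw k) (U.nsmul_mem (hw k) k)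
  simpa using this 0

lemma hp_end (m : M) (hm0 : m ≠ 0) (hg : ∀ w : M, ∃ a : In K 1, a • m = w)
    (h : ∀ f : Module.End (In K 1) M, ∃ c : K, f m = c • m) :
    Nonempty (Module.End (In K 1) M ≃ₐ[K] K) := by
  have : Nontrivial M := ⟨m, 0, hm0⟩
  refine ⟨(AlgEquiv.ofBijective (Algebra.ofId K (Module.End (In K 1) M)) ⟨?_, ?_⟩).symm⟩
  · intro a b hab
    have h2 : a • m = b • m := by
      have := congrArg (fun f : Module.End (In K 1) M => f m) hab
      simpa [Algebra.ofId_apply, Module.algebraMap_end_apply] using this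
    exact smul_left_injective K hm0 h2
  · intro f
    obtain ⟨c, hc⟩ := h f
    refine ⟨c, ?_⟩
    ext w
    obtain ⟨a, rfl⟩ := hg w
    rw [Algebra.ofId_apply, Module.algebraMap_end_apply, map_smul, hc, smul_comm]

lemma hp_case1 (v : M) (hv0 : v ≠ 0) (hv : dEl K 1 0 • v = 0)
    (hg : ∀ w : M, ∃ a : In K 1, a • v = w) :
    Nonempty (Module.End (In K 1) M ≃ₐ[K] K) := by
  have hE : ∀ u : M, dEl K 1 0 • u = 0 → hpE K • u = u := by
    intro u hu
    rw [hpE, sub_smul, mul_smul, hu]; simp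
  refine hp_end K v hv0 hg fun f => ?_
  have h1 := hp_E_mem K (Submodule.span K {v}) v ?_ hg (f v)
  · rw [hE _ (by rw [← map_smul, hv, map_zero])] at h1
    obtain ⟨c, hc⟩ := Submodule.mem_span_singleton.1 h1
    exact ⟨c, hc.symm⟩
  · intro k
    cases k with
    | zero => rw [pow_zero, one_smul, hE v hv]; exact Submodule.mem_span_singleton_self v
    | succ k => rw [pow_succ, mul_smul, hv]; simp

lemma hp_aeval (T : Module.End K M) (mu : K) (m : M) (h : T m = mu • m) (q : Polynomial K) :
    Polynomial.aeval T q m = q.eval mu • m := by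
  induction q using Polynomial.induction_on' with
  | add p q hp hq => simp [hp, hq, add_smul]
  | monomial k a =>
    have : ∀ k : ℕ, (T ^ k) m = mu ^ k • m := by
      intro k
      induction k with
      | zero => simp
      | succ k ih => rw [pow_succ, Module.End.mul_apply, h, map_smul, ih, smul_smul, pow_succ']
    rw [Polynomial.aeval_monomial, Module.End.mul_apply, this, Module.algebraMap_end_apply,
      Polynomial.eval_monomial, smul_smul]

lemma hp_case2 (mu : K) (m : M) (hm0 : m ≠ 0) (hm : HEl K 1 0 • m = mu • m)
    (hE : ∀ w : M, intEl K 1 0 • dEl K 1 0 • w = w)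
    (hg : ∀ w : M, ∃ a : In K 1, a • m = w) :
    Nonempty (Module.End (In K 1) M ≃ₐ[K] K) := by
  refine hp_end K m hm0 hg fun f => ?_
  have hHd : ∀ k : ℕ, HEl K 1 0 • (dEl K 1 0 ^ k) • m = (mu - k) • (dEl K 1 0 ^ k) • m := by
    intro k
    rw [← mul_smul, hp_H_dk, mul_smul, sub_smul, hm, Nat.cast_smul_eq_nsmul,
      ← Nat.cast_smul_eq_nsmul K, ← sub_smul, smul_comm]
  have hHi : ∀ k : ℕ, HEl K 1 0 • (intEl K 1 0 ^ k) • m = (mu + k) • (intEl K 1 0 ^ k) • m := by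
    intro k
    rw [← mul_smul, hp_H_intk, mul_smul, add_smul, hm, Nat.cast_smul_eq_nsmul,
      ← Nat.cast_smul_eq_nsmul K, ← add_smul, smul_comm]
  let S : Set M := Set.range (fun k : ℕ => (dEl K 1 0 ^ k) • m) ∪
    Set.range (fun k : ℕ => (intEl K 1 0 ^ k) • m)
  have hstab : ∀ a : In K 1, (∀ s ∈ S, a • s ∈ Submodule.span K S) →
      ∀ w ∈ Submodule.span K S, a • w ∈ Submodule.span K S := by
    intro a ha w hw
    induction hw using Submodule.span_induction with
    | mem x hx => exact ha x hx
    | zero => simp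
    | add x y _ _ h1 h2 => rw [smul_add]; exact Submodule.add_mem _ h1 h2
    | smul c x _ h1 => rw [← smul_comm c]; exact Submodule.smul_mem _ _ h1
  have hSd : ∀ k : ℕ, (dEl K 1 0 ^ k) • m ∈ Submodule.span K S := fun k =>
    Submodule.subset_span (Or.inl ⟨k, rfl⟩)
  have hSi : ∀ k : ℕ, (intEl K 1 0 ^ k) • m ∈ Submodule.span K S := fun k =>
    Submodule.subset_span (Or.inr ⟨k, rfl⟩)
  have htop : ∀ w : M, w ∈ Submodule.span K S := by
    intro w
    refine hp_top K (Submodule.span K S) (hstab _ ?_) (hstab _ ?_) (hstab _ ?_) m ?_ hg w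
    · rintro s (⟨k, rfl⟩ | ⟨k, rfl⟩)
      · show dEl K 1 0 • (dEl K 1 0 ^ k) • m ∈ _
        rw [← mul_smul, ← pow_succ']; exact hSd _
      · show dEl K 1 0 • (intEl K 1 0 ^ k) • m ∈ _
        cases k with
        | zero => simpa using hSd 1
        | succ k => rw [← mul_smul, pow_succ', ← mul_assoc, hp_R1, one_mul]; exact hSi k
    · rintro s (⟨k, rfl⟩ | ⟨k, rfl⟩)
      · show intEl K 1 0 • (dEl K 1 0 ^ k) • m ∈ _
        cases k with
        | zero => simpa using hSi 1
        | succ k => rw [pow_succ', mul_smul, hE]; exact hSd k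
      · show intEl K 1 0 • (intEl K 1 0 ^ k) • m ∈ _
        rw [← mul_smul, ← pow_succ']; exact hSi _
    · rintro s (⟨k, rfl⟩ | ⟨k, rfl⟩)
      · show HEl K 1 0 • (dEl K 1 0 ^ k) • m ∈ _
        rw [hHd]; exact Submodule.smul_mem _ _ (hSd k)
      · show HEl K 1 0 • (intEl K 1 0 ^ k) • m ∈ _
        rw [hHi]; exact Submodule.smul_mem _ _ (hSi k)
    · simpa using hSd 0
  let T : Module.End K M := DistribMulAction.toLinearMap K M (HEl K 1 0)
  have hT : ∀ w, T w = HEl K 1 0 • w := fun w => rfl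
  have hbase : ∀ (z : K) (w : M), z ≠ 0 → T w = (mu + z) • w → ∃ q : Polynomial K, q.eval mu ≠ 0 ∧
      ∃ c : K, Polynomial.aeval T q w = c • m := by
    intro z w hz hw
    refine ⟨Polynomial.X - Polynomial.C (mu + z), by simpa using hz, 0, ?_⟩
    simp [hw, Module.algebraMap_end_apply, add_smul]
  have hall : ∀ w : M, ∃ q : Polynomial K, q.eval mu ≠ 0 ∧
      ∃ c : K, Polynomial.aeval T q w = c • m := by
    intro w
    have hTm : T m = mu • m := hm
    have hev : ∀ q : Polynomial K, Polynomial.aeval T q m = q.eval mu • m := fun q =>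
      hp_aeval K T mu m hTm q
    induction htop w using Submodule.span_induction with
    | mem x hx =>
      rcases hx with ⟨k, rfl⟩ | ⟨k, rfl⟩
      · rcases Nat.eq_zero_or_pos k with rfl | hk
        · exact ⟨1, by simp, 1, by simp⟩
        · refine hbase (-(k:K)) _ (by simpa using hk.ne') ?_
          rw [hT, hHd, sub_eq_add_neg]
      · rcases Nat.eq_zero_or_pos k with rfl | hk
        · exact ⟨1, by simp, 1, by simp⟩
        · refine hbase (k:K) _ (by simpa using hk.ne') ?_
          rw [hT, hHi]
    | zero => exact ⟨1, by simp, 0, by simp⟩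
    | add x y _ _ h1 h2 =>
      obtain ⟨q, hq, c, hc⟩ := h1
      obtain ⟨r, hr, d, hd⟩ := h2
      refine ⟨q * r, by simp [hq, hr], r.eval mu * c + q.eval mu * d, ?_⟩
      rw [map_add, map_mul, Module.End.mul_apply, Module.End.mul_apply, hd, map_smul, hev,
        ← Module.End.mul_apply, ← map_mul, mul_comm q r, map_mul, Module.End.mul_apply, hc,
        map_smul, hev, smul_smul, smul_smul, add_smul, mul_comm c, mul_comm d]
    | smul a x _ h1 =>
      obtain ⟨q, hq, c, hc⟩ := h1
      exact ⟨q, hq, a * c, by rw [map_smul, hc, smul_smul]⟩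
  obtain ⟨q, hq, c, hc⟩ := hall (f m)
  have hfm : T (f m) = mu • f m := by
    rw [hT, ← map_smul, hm]
    obtain ⟨a, ha⟩ : ∃ a : In K 1, a = algebraMap K (In K 1) mu := ⟨_, rfl⟩
    rw [← algebraMap_smul (In K 1) mu m, map_smul, algebraMap_smul]
  rw [hp_aeval K T mu (f m) hfm q] at hc
  refine ⟨(q.eval mu)⁻¹ * c, ?_⟩
  rw [mul_smul, ← hc, smul_smul, inv_mul_cancel₀ hq, one_smul]

lemma hp_simple_gen [IsSimpleModule (In K 1) M] (m : M) (hm0 : m ≠ 0) (w : M) :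
    ∃ a : In K 1, a • m = w :=
  (IsSimpleModule.toSpanSingleton_surjective (In K 1) hm0) w

lemma hp_simple (hw : IsWeightModule K 1 M) (hs : IsSimpleModule (In K 1) M) :
    Nonempty (Module.End (In K 1) M ≃ₐ[K] K) := by
  by_cases h : ∃ v : M, v ≠ 0 ∧ dEl K 1 0 • v = 0
  · obtain ⟨v, hv0, hv⟩ := h
    exact hp_case1 K v hv0 hv (hp_simple_gen K v hv0)
  · push Not at h
    have hE : ∀ w : M, intEl K 1 0 • dEl K 1 0 • w = w := by
      intro w
      have h0 : hpE K • w = 0 := by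
        by_contra hne
        refine h _ hne ?_
        rw [← mul_smul, hp_d_E, zero_smul]
      rw [hpE, sub_smul, one_smul, mul_smul, sub_eq_zero] at h0
      exact h0.symm
    have hnt : Nontrivial M := IsSimpleModule.nontrivial (In K 1) M
    have hex : ∃ lam : Fin 1 → K, weightSpace K 1 M lam ≠ ⊥ := by
      by_contra hcon
      push Not at hcon
      let _ := Classical.decEq (Fin 1 → K)
      have htop := DirectSum.IsInternal.submodule_iSup_eq_top hw
      simp [hcon] at htop
    obtain ⟨lam, hlam⟩ := hex
    obtain ⟨m, hm, hm0⟩ := Submodule.exists_mem_ne_zero_of_ne_bot hlam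
    exact hp_case2 K (lam 0) m hm0 (hm 0) hE (hp_simple_gen K m hm0)

end Mods

lemma hp_poly : Nonempty (Module.End (In K 1) (P K 1) ≃ₐ[K] K) := by
  refine hp_case1 K (monomial 0 1 : P K 1) (by simp) (hp_d_zero K 1) fun w => ?_
  refine ⟨(show In K 1 from ⟨LinearMap.mulLeft K w, ?_⟩), ?_⟩
  · induction w using MvPolynomial.induction_on with
    | C a =>
      convert (InSub K 1).algebraMap_mem a using 1
      refine LinearMap.ext fun p => ?_
      rw [Module.algebraMap_end_apply, MvPolynomial.smul_eq_C_mul]; rfl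
    | add p q hp hq =>
      convert (InSub K 1).add_mem hp hq using 1
      ext; simp [add_mul]
    | mul_X p i hp =>
      convert (InSub K 1).mul_mem hp (show InSub K 1 from xEl K 1 i).2 using 1
      ext; simp [xEl, xOp, mul_assoc]
  · show w * monomial 0 1 = w
    simp

/-- divided powers -/
noncomputable def hpY (N : ℕ) : P K 1 := monomial (Finsupp.single 0 N) ((N.factorial : K)⁻¹)

/-- coordinate functionals -/
noncomputable def hpPhi (N : ℕ) : P K 1 →ₗ[K] K := (N.factorial : K) • MvPolynomial.lcoeff K (Finsupp.single 0 N)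

lemma hp_phi_mon (N : ℕ) (α : Fin 1 →₀ ℕ) (c : K) :
    hpPhi K N (monomial α c) = if α 0 = N then (N.factorial : K) * c else 0 := by
  have : α = Finsupp.single 0 N ↔ α 0 = N := by
    constructor
    · rintro rfl; simp
    · intro h; ext; simpa using h
  simp [hpPhi, MvPolynomial.coeff_monomial, this]

lemma hp_fact (N : ℕ) : (N.factorial : K) ≠ 0 := by exact_mod_cast N.factorial_ne_zero

lemma hp_phi_y (N M : ℕ) : hpPhi K N (hpY K M) = if M = N then 1 else 0 := by
  rw [hpY, hp_phi_mon, Finsupp.single_eq_same]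
  split_ifs with h
  · subst h; exact mul_inv_cancel₀ (hp_fact K _)
  · rfl

lemma hp_phi_ind (f g : P K 1 →ₗ[K] K) (h : ∀ α c, f (monomial α c) = g (monomial α c))
    (p : P K 1) : f p = g p := by
  induction p using MvPolynomial.induction_on' with
  | monomial α c => exact h α c
  | add p q hp hq => rw [map_add, map_add, hp, hq]

lemma hp_phi_d (N : ℕ) (p : P K 1) : hpPhi K N (dEl K 1 0 • p) = hpPhi K (N+1) p := by
  refine hp_phi_ind K ((hpPhi K N).comp (DistribMulAction.toLinearMap K _ (dEl K 1 0)))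
    (hpPhi K (N+1)) (fun α c => ?_) p
  show hpPhi K N (dEl K 1 0 • monomial α c) = _
  rcases hp_cases α with rfl | ⟨β, rfl⟩
  · rw [hp_d_zero, hp_phi_mon]; simp
  · rw [hp_d_monomial_succ, hp_phi_mon, hp_phi_mon]
    simp only [Finsupp.add_apply, Finsupp.single_eq_same, Nat.add_right_cancel_iff]
    split_ifs with h
    · rw [h, Nat.factorial_succ]; push_cast; ring
    · rfl

lemma hp_phi_int (N : ℕ) (p : P K 1) : hpPhi K (N+1) (intEl K 1 0 • p) = hpPhi K N p := by
  rw [← hp_phi_d, ← mul_smul, hp_R1, one_smul]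

lemma hp_phi_H (N : ℕ) (p : P K 1) : hpPhi K N (HEl K 1 0 • p) = ((N : K) + 1) * hpPhi K N p := by
  refine hp_phi_ind K ((hpPhi K N).comp (DistribMulAction.toLinearMap K _ (HEl K 1 0)))
    (((N : K) + 1) • hpPhi K N) (fun α c => ?_) p
  show hpPhi K N (HEl K 1 0 • monomial α c) = ((N : K) + 1) * hpPhi K N (monomial α c)
  rw [hp_H, hp_phi_mon, hp_phi_mon]
  split_ifs with h
  · rw [h]; ring
  · simp

lemma hp_d_y (N : ℕ) : dEl K 1 0 • hpY K (N+1) = hpY K N := by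
  rw [hpY, Finsupp.single_add, hp_d_monomial_succ, hpY]
  congr 1
  have := hp_fact K N
  have h2 : (N : K) + 1 ≠ 0 := by exact_mod_cast N.succ_ne_zero
  rw [Nat.factorial_succ]; push_cast
  simp; field_simp

lemma hp_dk_y (N k : ℕ) : dEl K 1 0 ^ k • hpY K (N+k) = hpY K N := by
  induction k with
  | zero => simp
  | succ k ih => rw [pow_succ, mul_smul, ← add_assoc, hp_d_y, ih]

lemma hp_int_y (N : ℕ) : intEl K 1 0 • hpY K N = hpY K (N+1) := by
  rw [hpY, hp_int_monomial, hpY, Finsupp.single_add]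
  congr 1
  rw [Nat.factorial_succ]; push_cast
  rw [mul_inv]; simp

lemma hp_E_y (N : ℕ) : hpE K • hpY K (N+1) = 0 := by
  rw [hpE, sub_smul, one_smul, mul_smul, hp_d_y, hp_int_y, sub_self]

lemma hp_H_y (N : ℕ) : HEl K 1 0 • hpY K N = ((N : K) + 1) • hpY K N := by
  rw [hpY, hEl_monomial]; simp

lemma hp_eEl1 (s t : ℕ) : eEl1 K s t = intEl K 1 0 ^ s * hpE K * dEl K 1 0 ^ t := by
  rw [eEl1, hpE, pow_succ, pow_succ']; noncomm_ring

lemma hp_F_y (b : In K 1) (hb : b ∈ Fideal K) : ∃ N₀, ∀ N ≥ N₀, b • hpY K N = 0 := by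
  induction hb using Submodule.span_induction with
  | mem x hx =>
    obtain ⟨s, t, rfl⟩ := hx
    refine ⟨t + 1, fun N hN => ?_⟩
    obtain ⟨j, rfl⟩ := Nat.exists_eq_add_of_le' hN
    rw [hp_eEl1, mul_smul, show j + (t + 1) = (j + 1) + t by ring, hp_dk_y, mul_smul, hp_E_y,
      smul_zero]
  | zero => exact ⟨0, by simp⟩
  | add x y _ _ h1 h2 =>
    obtain ⟨A, hA⟩ := h1
    obtain ⟨B, hB⟩ := h2
    refine ⟨A + B, fun N hN => ?_⟩
    rw [add_smul, hA N (by omega), hB N (by omega), add_zero]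
  | smul a x _ h1 =>
    obtain ⟨A, hA⟩ := h1
    exact ⟨A, fun N hN => by rw [smul_eq_mul, mul_smul, hA N hN, smul_zero]⟩

lemma hp_asym (a : In K 1) (i j : ℕ) : ∃ p : Polynomial K, ∃ N₀, ∀ N ≥ N₀,
    hpPhi K (N + i) (a • hpY K (N + j)) = p.eval (N : K) := by
  let W : Submodule K (In K 1) :=
    { carrier := {a | ∀ i j : ℕ, ∃ p : Polynomial K, ∃ N₀, ∀ N ≥ N₀,
        hpPhi K (N + i) (a • hpY K (N + j)) = p.eval (N : K)}
      add_mem' := by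
        intro a b ha hb i j
        obtain ⟨p, A, hA⟩ := ha i j
        obtain ⟨q, B, hB⟩ := hb i j
        refine ⟨p + q, A + B, fun N hN => ?_⟩
        rw [add_smul, map_add, hA N (by omega), hB N (by omega), Polynomial.eval_add]
      zero_mem' := fun i j => ⟨0, 0, by simp⟩
      smul_mem' := by
        intro c a ha i j
        obtain ⟨p, A, hA⟩ := ha i j
        refine ⟨Polynomial.C c * p, A, fun N hN => ?_⟩
        rw [smul_assoc, map_smul, hA N hN]; simp }
  have : a ∈ W := by
    refine hp_top K W ?_ ?_ ?_ 1 ?_ (fun w => ⟨w, mul_one w⟩) a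
    · intro w hw i j
      obtain ⟨p, A, hA⟩ := hw (i+1) j
      refine ⟨p, A, fun N hN => ?_⟩
      rw [smul_eq_mul, mul_smul, hp_phi_d, add_assoc, hA N hN]
    · intro w hw i j
      cases i with
      | zero =>
        obtain ⟨p, A, hA⟩ := hw 0 (j+1)
        refine ⟨p.comp (Polynomial.X - 1), A + 1, fun N hN => ?_⟩
        obtain ⟨L, rfl⟩ := Nat.exists_eq_add_of_le' (show 1 ≤ N by omega)
        have := hA L (by omega)
        rw [smul_eq_mul, mul_smul, add_zero, hp_phi_int, show L + 1 + j = L + (j + 1) by ring]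
        rw [add_zero] at this
        rw [this]; simp
      | succ i =>
        obtain ⟨p, A, hA⟩ := hw i j
        refine ⟨p, A, fun N hN => ?_⟩
        rw [smul_eq_mul, mul_smul, ← add_assoc, hp_phi_int, hA N hN]
    · intro w hw i j
      obtain ⟨p, A, hA⟩ := hw i j
      refine ⟨(Polynomial.X + Polynomial.C (i : K) + 1) * p, A, fun N hN => ?_⟩
      rw [smul_eq_mul, mul_smul, hp_phi_H, hA N hN]; simp
    · intro i j
      refine ⟨Polynomial.C (if j = i then 1 else 0), 0, fun N _ => ?_⟩
      rw [one_smul, hp_phi_y, Polynomial.eval_C]; simp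
  exact this i j

lemma hp_one_notMem (mu : K) : (1 : In K 1) ∉ MslIdeal K 1 mu := by
  intro h
  obtain ⟨f, hf, g, hg, hfg⟩ := Submodule.mem_sup.1 h
  obtain ⟨a, rfl⟩ := Submodule.mem_span_singleton.1 hg
  obtain ⟨A, hA⟩ := hp_F_y K f hf
  obtain ⟨p, B, hB⟩ := hp_asym K a 0 0
  have key : ∀ N ≥ A + B, ((Polynomial.X + 1 - Polynomial.C mu) * p - 1).eval (N : K) = 0 := by
    intro N hN
    have h1 : hpPhi K N ((1 : In K 1) • hpY K N) = 1 := by rw [one_smul, hp_phi_y]; simp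
    have h2 := hB N (by omega)
    rw [add_zero] at h2
    rw [← hfg, add_smul, hA N (by omega), zero_add, pow_one, smul_eq_mul, mul_smul, sub_smul,
      hp_H_y, algebraMap_smul, ← sub_smul, ← smul_comm, map_smul, h2] at h1
    simp only [Polynomial.eval_sub, Polynomial.eval_mul, Polynomial.eval_add, Polynomial.eval_X,
      Polynomial.eval_one, Polynomial.eval_C]
    rw [smul_eq_mul] at h1
    rw [h1, sub_self]
  have h0 : (Polynomial.X + 1 - Polynomial.C mu) * p - 1 = 0 := by
    apply Polynomial.eq_zero_of_infinite_isRoot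
    refine Set.Infinite.mono (s := Set.range fun k : ℕ => ((A + B + k : ℕ) : K)) ?_ ?_
    · rintro _ ⟨k, rfl⟩
      exact key _ (by omega)
    · apply Set.infinite_range_of_injective
      intro x y hxy
      have : A + B + x = A + B + y := Nat.cast_injective (R := K) hxy
      omega
  have := congrArg (Polynomial.eval (mu - 1)) h0
  simp at this

lemma hp_Msl (mu : K) : Nonempty (Module.End (In K 1) (Msl K 1 mu) ≃ₐ[K] K) := by
  let q : In K 1 →ₗ[In K 1] Msl K 1 mu := (MslIdeal K 1 mu).mkQ
  have hq : ∀ a, q a = 0 ↔ a ∈ MslIdeal K 1 mu := fun a =>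
    Submodule.Quotient.mk_eq_zero (MslIdeal K 1 mu)
  have hs : ∀ a : In K 1, a • q 1 = q a := fun a => by rw [← map_smul, smul_eq_mul, mul_one]
  have hg : ∀ w : Msl K 1 mu, ∃ a : In K 1, a • q 1 = w := by
    intro w
    obtain ⟨a, rfl⟩ := (MslIdeal K 1 mu).mkQ_surjective w
    exact ⟨a, hs a⟩
  refine hp_case2 K mu (q 1) (fun h => hp_one_notMem K mu ((hq 1).1 h)) ?_ ?_ hg
  · rw [← algebraMap_smul (In K 1) mu (q 1), ← sub_eq_zero, ← sub_smul, hs, hq]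
    refine Submodule.mem_sup_right ?_
    rw [pow_one]
    exact Submodule.mem_span_singleton_self _
  · intro w
    have h0 := hp_E_mem K (⊥ : Submodule K (Msl K 1 mu)) (q 1) ?_ hg w
    · rw [Submodule.mem_bot, hpE, sub_smul, one_smul, mul_smul, sub_eq_zero] at h0
      exact h0.symm
    · intro k
      rw [Submodule.mem_bot, ← mul_smul, hs, hq]
      refine Submodule.mem_sup_left (Submodule.subset_span ⟨0, k, ?_⟩)
      rw [hp_eEl1, pow_zero, one_mul]

end Helpers

/-- `End_{𝕀_1}(M) ≅ K` for every simple weight `𝕀_1`-module `M`; in particular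
for `K[x]` and for the modules `M(1,λ)`. -/
theorem statement3 (K : Type*) [Field K] [CharZero K] :
    (∀ (M : Type*) [AddCommGroup M] [Module K M] [Module (In K 1) M] [IsScalarTower K (In K 1) M],
      IsWeightModule K 1 M → IsSimpleModule (In K 1) M →
      Nonempty (Module.End (In K 1) M ≃ₐ[K] K)) ∧
    Nonempty (Module.End (In K 1) (P K 1) ≃ₐ[K] K) ∧
    (∀ mu : K, Nonempty (Module.End (In K 1) (Msl K 1 mu) ≃ₐ[K] K)) := by
  exact ⟨fun M _ _ _ _ hw hs => hp_simple K hw hs, hp_poly K, hp_Msl K⟩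

end IDO
end

section
/- Every simple generalized weight 𝕀_n-module is a simple weight 𝕀_n-module, and vice versa. Every simple weight 𝕀_n-module is isomorphic to a tensor product M_1⊗⋯⊗M_n of simple weight 𝕀_1(i)-modules, and two such tensor products are isomorphic as 𝕀_n-modules, M_1⊗⋯⊗M_n ≅ M_1′⊗⋯⊗M_n′, if and only if M_i ≅ M_i′ as 𝕀_1(i)-modules for every i = 1,…,n. -/
set_option maxHeartbeats 1000000
set_option synthInstance.maxHeartbeats 400000
set_option linter.unusedSectionVars false

namespace IDO

open scoped TensorProduct

set_option maxHeartbeats 1000000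
set_option synthInstance.maxHeartbeats 400000
set_option linter.unusedSectionVars false
set_option linter.unusedSimpArgs false

section AlgA
variable {K : Type*} [Field K] [CharZero K] {n : ℕ}

lemma sx_In_ext {a b : In K n} (h : ∀ α : Fin n →₀ ℕ,
    a • (MvPolynomial.monomial α (1:K) : P K n) = b • (MvPolynomial.monomial α (1:K) : P K n)) :
    a = b := by
  have : (show InSub K n from a) = (show InSub K n from b) := by
    refine Subtype.ext ((MvPolynomial.basisMonomials (Fin n) K).ext fun α => ?_)
    rw [MvPolynomial.coe_basisMonomials]
    exact h α
  exact this

lemma sx_x_mon (i : Fin n) (α : Fin n →₀ ℕ) (c : K) :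
    xEl K n i • (MvPolynomial.monomial α c : P K n)
      = MvPolynomial.monomial (α + Finsupp.single i 1) c := by
  rw [xEl_smul, MvPolynomial.X, MvPolynomial.monomial_mul, one_mul, add_comm]

lemma sx_d_mon (i : Fin n) (α : Fin n →₀ ℕ) (c : K) :
    dEl K n i • (MvPolynomial.monomial α c : P K n)
      = MvPolynomial.monomial (α - Finsupp.single i 1) (c * α i) := by
  rw [dEl_smul, MvPolynomial.pderiv_monomial]

lemma sx_int_mon (i : Fin n) (α : Fin n →₀ ℕ) (c : K) :
    intEl K n i • (MvPolynomial.monomial α c : P K n)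
      = MvPolynomial.monomial (α + Finsupp.single i 1) (c * ((α i : K) + 1)⁻¹) := by
  have h1 : intEl K n i • (MvPolynomial.monomial α (1:K) : P K n)
      = MvPolynomial.monomial (α + Finsupp.single i 1) (((α i : K) + 1)⁻¹) := by
    have := (MvPolynomial.basisMonomials (Fin n) K).constr_basis K
      (fun α => (((α i : ℕ) : K) + 1)⁻¹ •
      (MvPolynomial.monomial (α + Finsupp.single i 1) (1 : K))) α
    rw [MvPolynomial.coe_basisMonomials] at this
    refine Eq.trans this ?_
    rw [MvPolynomial.smul_monomial, smul_eq_mul, mul_one]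
  have h2 : (MvPolynomial.monomial α c : P K n) = c • MvPolynomial.monomial α (1:K) := by
    rw [MvPolynomial.smul_monomial, smul_eq_mul, mul_one]
  rw [h2, ← smul_comm c (intEl K n i), h1, MvPolynomial.smul_monomial, smul_eq_mul]

lemma sx_H_mon (i : Fin n) (α : Fin n →₀ ℕ) (c : K) :
    HEl K n i • (MvPolynomial.monomial α c : P K n)
      = MvPolynomial.monomial α (c * ((α i : K) + 1)) := by
  rw [hEl_monomial, MvPolynomial.smul_monomial, smul_eq_mul, mul_comm]

lemma sx_ne (k : ℕ) : ((k : K) + 1) ≠ 0 := by exact_mod_cast Nat.succ_ne_zero k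

lemma sx_d_int (i : Fin n) : dEl K n i * intEl K n i = 1 := by
  refine sx_In_ext fun α => ?_
  rw [mul_smul, one_smul, sx_int_mon, sx_d_mon]
  have := sx_ne (K := K) (α i)
  congr 1
  · simp
  · simp [this]

lemma sx_int_H (i : Fin n) : intEl K n i * HEl K n i = xEl K n i := by
  refine sx_In_ext fun α => ?_
  have := sx_ne (K := K) (α i)
  rw [mul_smul, sx_H_mon, sx_int_mon, sx_x_mon]
  simp [this]

lemma sx_H_int (i : Fin n) : HEl K n i * intEl K n i = intEl K n i * HEl K n i + intEl K n i := by
  refine sx_In_ext fun α => ?_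
  have := sx_ne (K := K) (α i)
  rw [add_smul, mul_smul, mul_smul, sx_H_mon, sx_int_mon, sx_H_mon, sx_int_mon, ← map_add]
  congr 1
  simp
  field_simp

lemma sx_d_H (i : Fin n) : dEl K n i * HEl K n i = HEl K n i * dEl K n i + dEl K n i := by
  refine sx_In_ext fun α => ?_
  rw [add_smul, mul_smul, mul_smul, sx_H_mon, sx_d_mon, sx_d_mon, sx_H_mon, ← map_add]
  rcases Nat.eq_zero_or_pos (α i) with h | h
  · simp [h]
  · congr 1
    simp [Nat.cast_sub (show 1 ≤ α i from h)]
    ring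

lemma sx_H_int_ne {i j : Fin n} (h : i ≠ j) : Commute (HEl K n i) (intEl K n j) := by
  refine sx_In_ext fun α => ?_
  rw [mul_smul, mul_smul, sx_H_mon, sx_int_mon, sx_H_mon, sx_int_mon]
  congr 1
  simp [h.symm, mul_comm]

lemma sx_H_d_ne {i j : Fin n} (h : i ≠ j) : Commute (HEl K n i) (dEl K n j) := by
  refine sx_In_ext fun α => ?_
  rw [mul_smul, mul_smul, sx_H_mon, sx_d_mon, sx_H_mon, sx_d_mon]
  congr 1
  simp [h.symm, mul_comm]

lemma sx_int_int (i j : Fin n) : Commute (intEl K n i) (intEl K n j) := by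
  by_cases h : i = j
  · rw [h]
  refine sx_In_ext fun α => ?_
  rw [mul_smul, mul_smul, sx_int_mon, sx_int_mon, sx_int_mon, sx_int_mon]
  congr 1
  · rw [add_right_comm]
  · simp [h, Ne.symm h, mul_comm]

lemma sx_d_d (i j : Fin n) : Commute (dEl K n i) (dEl K n j) := by
  by_cases h : i = j
  · rw [h]
  refine sx_In_ext fun α => ?_
  rw [mul_smul, mul_smul, sx_d_mon, sx_d_mon, sx_d_mon, sx_d_mon]
  congr 1
  · rw [tsub_right_comm]
  · simp [h, Ne.symm h, mul_comm]

lemma sx_d_int_ne {i j : Fin n} (h : i ≠ j) : Commute (dEl K n i) (intEl K n j) := by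
  refine sx_In_ext fun α => ?_
  rw [mul_smul, mul_smul, sx_int_mon, sx_d_mon, sx_d_mon, sx_int_mon]
  congr 1
  · congr 1
    refine Finsupp.ext fun k => ?_
    by_cases h1 : k = i
    · subst h1; simp [h]
    · simp [h1]
  · simp [h, Ne.symm h, mul_comm]

/-- `e_i = 1 - ∫_i ∂_i`. -/
noncomputable def sxE (K : Type*) [Field K] [CharZero K] (n : ℕ) (i : Fin n) : In K n :=
  1 - intEl K n i * dEl K n i

lemma sx_d_e (i : Fin n) : dEl K n i * sxE K n i = 0 := by
  rw [sxE, mul_sub, ← mul_assoc, sx_d_int]; simp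

lemma sx_e_comm_d {i j : Fin n} (h : i ≠ j) : Commute (sxE K n i) (dEl K n j) :=
  (Commute.one_left _).sub_left (((sx_d_int_ne h.symm).symm).mul_left (sx_d_d _ _))

lemma sx_e_comm_int {i j : Fin n} (h : i ≠ j) : Commute (sxE K n i) (intEl K n j) :=
  (Commute.one_left _).sub_left ((sx_int_int _ _).mul_left (sx_d_int_ne h))

lemma sx_e_comm_e (i j : Fin n) : Commute (sxE K n i) (sxE K n j) := by
  by_cases h : i = j
  · rw [h]
  · exact (Commute.one_right _).sub_right ((sx_e_comm_int h).mul_right (sx_e_comm_d h))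

/-- generators generate -/
lemma sx_induct (p : In K n → Prop) (hx : ∀ i, p (xEl K n i)) (hd : ∀ i, p (dEl K n i))
    (hi : ∀ i, p (intEl K n i)) (hc : ∀ c : K, p (algebraMap K (In K n) c))
    (hadd : ∀ a b, p a → p b → p (a + b)) (hmul : ∀ a b, p a → p b → p (a * b)) (a : In K n) :
    p a := by
  have key : ∀ (y : Module.End K (P K n)) (hy : y ∈ InSub K n), p (show InSub K n from ⟨y, hy⟩) := by
    intro y hy
    induction hy using Algebra.adjoin_induction with
    | mem x hx' =>
      rcases hx' with (⟨i, rfl⟩ | ⟨i, rfl⟩) | ⟨i, rfl⟩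
      · exact hx i
      · exact hd i
      · exact hi i
    | algebraMap r => exact hc r
    | add x y hx hy h1 h2 => exact hadd _ _ h1 h2
    | mul x y hx hy h1 h2 => exact hmul _ _ h1 h2
  exact key (show InSub K n from a).1 (show InSub K n from a).2

variable {M : Type*} [AddCommGroup M] [Module K M] [Module (In K n) M] [IsScalarTower K (In K n) M]
variable {M' : Type*} [AddCommGroup M'] [Module K M'] [Module (In K n) M']
  [IsScalarTower K (In K n) M']

lemma sx_map_smul (g : M →ₗ[K] M')
    (hx : ∀ i m, g (xEl K n i • m) = xEl K n i • g m)
    (hd : ∀ i m, g (dEl K n i • m) = dEl K n i • g m)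
    (hi : ∀ i m, g (intEl K n i • m) = intEl K n i • g m) (a : In K n) :
    ∀ m : M, g (a • m) = a • g m := by
  refine sx_induct (fun a => ∀ m : M, g (a • m) = a • g m) hx hd hi ?_ ?_ ?_ a
  · intro c m; rw [algebraMap_smul, algebraMap_smul, map_smul]
  · intro a b ha hb m; rw [add_smul, map_add, ha, hb, add_smul]
  · intro a b ha hb m; rw [mul_smul, ha, hb, mul_smul]

lemma sx_stable (p : Submodule K M)
    (hx : ∀ i, ∀ m ∈ p, xEl K n i • m ∈ p)
    (hd : ∀ i, ∀ m ∈ p, dEl K n i • m ∈ p)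
    (hi : ∀ i, ∀ m ∈ p, intEl K n i • m ∈ p) (a : In K n) :
    ∀ m ∈ p, a • m ∈ p := by
  refine sx_induct (fun a => ∀ m ∈ p, a • m ∈ p) hx hd hi ?_ ?_ ?_ a
  · intro c m hm; rw [algebraMap_smul]; exact p.smul_mem _ hm
  · intro a b ha hb m hm; rw [add_smul]; exact p.add_mem (ha m hm) (hb m hm)
  · intro a b ha hb m hm; rw [mul_smul]; exact ha _ (hb m hm)

end AlgA

section Iota
variable (K : Type*) [Field K] [CharZero K] (n : ℕ)

lemma sx_end_ext {V : Type*} [AddCommGroup V] [Module K V] {f g : P K n →ₗ[K] V}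
    (h : ∀ α : Fin n →₀ ℕ, f (MvPolynomial.monomial α 1) = g (MvPolynomial.monomial α 1)) :
    f = g := by
  refine (MvPolynomial.basisMonomials (Fin n) K).ext fun α => ?_
  rw [MvPolynomial.coe_basisMonomials]
  exact h α

noncomputable def sxExt (i : Fin n) (a : Module.End K (P K 1)) : Module.End K (P K n) :=
  (MvPolynomial.basisMonomials (Fin n) K).constr K
    (fun α => MvPolynomial.rename (fun _ => i) (a (MvPolynomial.monomial (Finsupp.single 0 (α i)) 1))
      * MvPolynomial.monomial (α.erase i) (1:K))

lemma sxExt_mon (i : Fin n) (a : Module.End K (P K 1)) (α : Fin n →₀ ℕ) :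
    sxExt K n i a (MvPolynomial.monomial α 1) =
      MvPolynomial.rename (fun _ => i) (a (MvPolynomial.monomial (Finsupp.single 0 (α i)) 1))
      * MvPolynomial.monomial (α.erase i) (1:K) := by
  have := (MvPolynomial.basisMonomials (Fin n) K).constr_basis K
    (fun α => MvPolynomial.rename (fun _ => i) (a (MvPolynomial.monomial (Finsupp.single 0 (α i)) 1))
      * MvPolynomial.monomial (α.erase i) (1:K)) α
  rw [MvPolynomial.coe_basisMonomials] at this
  exact this

lemma sxExt_mul (i : Fin n) (a : Module.End K (P K 1)) (p : P K 1) (β : Fin n →₀ ℕ)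
    (hβ : β i = 0) :
    sxExt K n i a (MvPolynomial.rename (fun _ => i) p * MvPolynomial.monomial β 1) =
      MvPolynomial.rename (fun _ => i) (a p) * MvPolynomial.monomial β (1:K) := by
  induction p using MvPolynomial.induction_on' with
  | monomial γ c =>
    have hγ : γ = Finsupp.single 0 (γ 0) := by
      refine Finsupp.ext fun k => ?_
      rw [Subsingleton.elim k 0]; simp
    have hc : (MvPolynomial.monomial γ c : P K 1)
        = c • MvPolynomial.monomial (Finsupp.single 0 (γ 0)) (1:K) := by
      rw [MvPolynomial.smul_monomial, smul_eq_mul, mul_one, ← hγ]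
    rw [hc, map_smul, map_smul, map_smul, smul_mul_assoc, smul_mul_assoc, map_smul,
      MvPolynomial.rename_monomial, MvPolynomial.monomial_mul, one_mul, sxExt_mon]
    have h1 : (Finsupp.mapDomain (fun _ => i) (Finsupp.single (0 : Fin 1) (γ 0)) + β) i = γ 0 := by
      simp [Finsupp.mapDomain_single, hβ]
    have h2 : (Finsupp.mapDomain (fun _ => i) (Finsupp.single (0 : Fin 1) (γ 0)) + β).erase i
        = β := by
      ext k
      rw [Finsupp.mapDomain_single]
      by_cases hk : k = i
      · subst hk; simp [hβ]
      · simp [hk, Finsupp.single_apply, Ne.symm hk]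
    rw [h1, h2]
  | add p q hp hq => rw [map_add, add_mul, map_add, hp, hq, map_add, map_add, add_mul]

lemma sx_mon_split (i : Fin n) (α : Fin n →₀ ℕ) :
    (MvPolynomial.rename (fun _ => i) (MvPolynomial.monomial (Finsupp.single (0:Fin 1) (α i)) (1:K))
      * MvPolynomial.monomial (α.erase i) (1:K) : P K n) = MvPolynomial.monomial α 1 := by
  rw [MvPolynomial.rename_monomial, MvPolynomial.monomial_mul, one_mul,
    Finsupp.mapDomain_single, Finsupp.single_add_erase]

noncomputable def sxExtHom (i : Fin n) : Module.End K (P K 1) →ₐ[K] Module.End K (P K n) :=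
  AlgHom.ofLinearMap
    { toFun := sxExt K n i
      map_add' := by
        intro a b
        refine sx_end_ext K n fun α => ?_
        rw [LinearMap.add_apply, sxExt_mon, sxExt_mon, sxExt_mon,
          LinearMap.add_apply, map_add, add_mul]
      map_smul' := by
        intro c a
        refine sx_end_ext K n fun α => ?_
        rw [RingHom.id_apply, LinearMap.smul_apply, sxExt_mon,
          sxExt_mon, LinearMap.smul_apply, map_smul, smul_mul_assoc] }
    (by
      refine sx_end_ext K n fun α => ?_
      change sxExt K n i 1 _ = _
      rw [sxExt_mon, Module.End.one_apply, Module.End.one_apply, sx_mon_split])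
    (by
      intro a b
      refine sx_end_ext K n fun α => ?_
      change sxExt K n i (a * b) _ = sxExt K n i a (sxExt K n i b _)
      rw [sxExt_mon, sxExt_mon, sxExt_mul _ _ _ _ _ _ (by simp), Module.End.mul_apply])

lemma sxExt_x (i : Fin n) : sxExtHom K n i (xOp K 1 0) = xOp K n i := by
  refine sx_end_ext K n fun α => ?_
  change sxExt K n i _ _ = xEl K n i • _
  rw [sxExt_mon, sx_x_mon]
  change MvPolynomial.rename _ (xEl K 1 0 • _) * _ = _
  rw [sx_x_mon, MvPolynomial.rename_monomial, MvPolynomial.monomial_mul, one_mul,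
    ← Finsupp.single_add, Finsupp.mapDomain_single, Finsupp.single_add, add_right_comm,
    Finsupp.single_add_erase]

lemma sxExt_int (i : Fin n) : sxExtHom K n i (intOp K 1 0) = intOp K n i := by
  refine sx_end_ext K n fun α => ?_
  change sxExt K n i _ _ = intEl K n i • _
  rw [sxExt_mon, sx_int_mon]
  change MvPolynomial.rename _ (intEl K 1 0 • _) * _ = _
  rw [sx_int_mon, MvPolynomial.rename_monomial, MvPolynomial.monomial_mul, mul_one,
    ← Finsupp.single_add, Finsupp.mapDomain_single, Finsupp.single_add, add_right_comm,
    Finsupp.single_add_erase, Finsupp.single_eq_same]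

lemma sxExt_d (i : Fin n) : sxExtHom K n i (dOp K 1 0) = dOp K n i := by
  refine sx_end_ext K n fun α => ?_
  change sxExt K n i _ _ = dEl K n i • _
  rw [sxExt_mon, sx_d_mon]
  change MvPolynomial.rename _ (dEl K 1 0 • _) * _ = _
  rw [sx_d_mon, MvPolynomial.rename_monomial, MvPolynomial.monomial_mul, mul_one,
    ← Finsupp.single_tsub, Finsupp.mapDomain_single, Finsupp.single_eq_same]
  congr 2
  ext k
  by_cases hk : k = i
  · subst hk; simp
  · simp [hk, Finsupp.single_apply, Ne.symm hk]

lemma sxExt_mem (i : Fin n) : InSub K 1 ≤ (InSub K n).comap (sxExtHom K n i) := by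
  refine Algebra.adjoin_le ?_
  rintro _ ((⟨j, rfl⟩ | ⟨j, rfl⟩) | ⟨j, rfl⟩) <;> rw [Subsingleton.elim j 0] <;>
    simp only [SetLike.mem_coe, Subalgebra.mem_comap]
  · rw [sxExt_x]; exact (show InSub K n from xEl K n i).2
  · rw [sxExt_d]; exact (show InSub K n from dEl K n i).2
  · rw [sxExt_int]; exact (show InSub K n from intEl K n i).2

/-- The embedding of `𝕀_1` in `𝕀_n` as the `i`-th tensor factor. -/
noncomputable def sxIota (i : Fin n) : In K 1 →ₐ[K] In K n :=
  show InSub K 1 →ₐ[K] InSub K n from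
  ((sxExtHom K n i).comp (InSub K 1).val).codRestrict (InSub K n)
    (fun a => sxExt_mem K n i a.2)

lemma sxIota_x (i : Fin n) : sxIota K n i (xEl K 1 0) = xEl K n i :=
  Subtype.ext (sxExt_x K n i)
lemma sxIota_d (i : Fin n) : sxIota K n i (dEl K 1 0) = dEl K n i :=
  Subtype.ext (sxExt_d K n i)
lemma sxIota_int (i : Fin n) : sxIota K n i (intEl K 1 0) = intEl K n i :=
  Subtype.ext (sxExt_int K n i)
lemma sxIota_H (i : Fin n) : sxIota K n i (HEl K 1 0) = HEl K n i := by
  rw [HEl, map_mul, sxIota_x, sxIota_d]; rfl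
lemma sxIota_e (i : Fin n) : sxIota K n i (sxE K 1 0) = sxE K n i := by
  rw [sxE, map_sub, map_mul, sxIota_int, sxIota_d, map_one]; rfl

end Iota

section Wt
variable {K : Type*} [Field K] [CharZero K] {n : ℕ}
variable {M : Type*} [AddCommGroup M] [Module K M] [Module (In K n) M] [IsScalarTower K (In K n) M]

noncomputable def sxHop (K : Type*) [Field K] [CharZero K] (n : ℕ) (M : Type*) [AddCommGroup M]
    [Module K M] [Module (In K n) M] [IsScalarTower K (In K n) M] (i : Fin n) : Module.End K M :=
  Algebra.lsmul K K M (HEl K n i)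

lemma sx_Hop_pow (i : Fin n) (c : K) (N : ℕ) (m : M) :
    ((sxHop K n M i - c • (1 : Module.End K M)) ^ N) m
      = ((HEl K n i - algebraMap K (In K n) c) ^ N) • m := by
  have : sxHop K n M i - c • (1 : Module.End K M)
      = Algebra.lsmul K K M (HEl K n i - algebraMap K (In K n) c) := by
    rw [map_sub, AlgHom.commutes, Algebra.algebraMap_eq_smul_one]; rfl
  rw [this, ← map_pow]; rfl

lemma sx_gen_le (lam : Fin n → K) :
    genWeightSpace K n M lam ≤ ⨅ i, (sxHop K n M i).maxGenEigenspace (lam i) := by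
  rintro m ⟨N, hN⟩
  rw [Submodule.mem_iInf]
  intro i
  rw [Module.End.mem_maxGenEigenspace]
  exact ⟨N, by rw [sx_Hop_pow]; exact hN i⟩

lemma sx_wt_le (lam : Fin n → K) : weightSpace K n M lam ≤ genWeightSpace K n M lam := by
  intro m hm
  refine ⟨1, fun i => ?_⟩
  rw [pow_one, sub_smul, algebraMap_smul, hm i, sub_self]

lemma sx_gen_indep : iSupIndep (fun lam : Fin n → K => genWeightSpace K n M lam) := by
  refine iSupIndep.mono (Module.End.independent_iInf_maxGenEigenspace_of_forall_mapsTo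
    (sxHop K n M) ?_) sx_gen_le
  intro i j φ
  refine Module.End.mapsTo_maxGenEigenspace_of_comm ?_ φ
  change _ * _ = _ * _
  rw [sxHop, sxHop, ← map_mul, ← map_mul, hEl_comm]

lemma sx_wt_indep : iSupIndep (fun lam : Fin n → K => weightSpace K n M lam) :=
  iSupIndep.mono sx_gen_indep sx_wt_le

lemma sx_isWeight_iff : IsWeightModule K n M ↔ (⨆ lam, weightSpace K n M lam) = ⊤ := by
  unfold IsWeightModule
  let _ := Classical.decEq (Fin n → K)
  exact (DirectSum.isInternal_submodule_iff_iSupIndep_and_iSup_eq_top _).trans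
    ⟨fun h => h.2, fun h => ⟨sx_wt_indep, h⟩⟩

lemma sx_isGen_iff : IsGenWeightModule K n M ↔ (⨆ lam, genWeightSpace K n M lam) = ⊤ := by
  unfold IsGenWeightModule
  let _ := Classical.decEq (Fin n → K)
  exact (DirectSum.isInternal_submodule_iff_iSupIndep_and_iSup_eq_top _).trans
    ⟨fun h => h.2, fun h => ⟨sx_gen_indep, h⟩⟩

lemma sx_wt_int {lam : Fin n → K} {m : M} (hm : m ∈ weightSpace K n M lam) (i : Fin n) :
    intEl K n i • m ∈ weightSpace K n M (lam + Pi.single i 1) := by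
  intro j
  by_cases h : j = i
  · subst h
    rw [← mul_smul, sx_H_int, add_smul, mul_smul, hm j, ← smul_comm (lam j)]
    simp [add_smul]
  · rw [← mul_smul, (sx_H_int_ne h).eq, mul_smul, hm j, ← smul_comm (lam j)]
    simp [h]

lemma sx_wt_d {lam : Fin n → K} {m : M} (hm : m ∈ weightSpace K n M lam) (i : Fin n) :
    dEl K n i • m ∈ weightSpace K n M (lam - Pi.single i 1) := by
  intro j
  by_cases h : j = i
  · subst h
    have : HEl K n j * dEl K n j = dEl K n j * HEl K n j - dEl K n j := by
      rw [sx_d_H]; abel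
    rw [← mul_smul, this, sub_smul, mul_smul, hm j, ← smul_comm (lam j)]
    simp [sub_smul]
  · rw [← mul_smul, (sx_H_d_ne h).eq, mul_smul, hm j, ← smul_comm (lam j)]
    simp [h]

lemma sx_wt_x {lam : Fin n → K} {m : M} (hm : m ∈ weightSpace K n M lam) (i : Fin n) :
    xEl K n i • m ∈ weightSpace K n M (lam + Pi.single i 1) := by
  rw [← sx_int_H, mul_smul, hm i, ← smul_comm (lam i)]
  exact Submodule.smul_mem _ _ (sx_wt_int hm i)

lemma sx_wt_e {lam : Fin n → K} {m : M} (hm : m ∈ weightSpace K n M lam) (i : Fin n) :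
    sxE K n i • m ∈ weightSpace K n M lam := by
  rw [sxE, sub_smul, one_smul, mul_smul]
  refine Submodule.sub_mem _ hm ?_
  simpa using sx_wt_int (sx_wt_d hm i) i

lemma sx_wt_dpow {lam : Fin n → K} {m : M} (hm : m ∈ weightSpace K n M lam) (i : Fin n) (k : ℕ) :
    ∃ mu, (dEl K n i ^ k) • m ∈ weightSpace K n M mu := by
  induction k with
  | zero => exact ⟨lam, by simpa using hm⟩
  | succ k ih =>
    obtain ⟨mu, h⟩ := ih
    exact ⟨_, by rw [pow_succ', mul_smul]; exact sx_wt_d h i⟩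

lemma sx_weight_of_vec [IsSimpleModule (In K n) M] {lam : Fin n → K} {v : M} (hv : v ≠ 0)
    (hw : v ∈ weightSpace K n M lam) : IsWeightModule K n M := by
  rw [sx_isWeight_iff, eq_top_iff]
  set p := ⨆ lam, weightSpace K n M lam with hp
  have hmap : ∀ (a : In K n) (f : (Fin n → K) → (Fin n → K)),
      (∀ mu, ∀ m ∈ weightSpace K n M mu, a • m ∈ weightSpace K n M (f mu)) →
      ∀ m ∈ p, a • m ∈ p := by
    intro a f hf m hm
    have : p ≤ p.comap (Algebra.lsmul K K M a) := by
      refine iSup_le fun mu m hm => ?_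
      exact Submodule.mem_iSup_of_mem (f mu) (hf mu m hm)
    exact this hm
  have hst := sx_stable p
    (fun i => hmap _ _ (fun mu m hm => sx_wt_x hm i))
    (fun i => hmap _ _ (fun mu m hm => sx_wt_d hm i))
    (fun i => hmap _ _ (fun mu m hm => sx_wt_int hm i))
  intro m _
  obtain ⟨a, rfl⟩ := IsSimpleModule.toSpanSingleton_surjective (In K n) hv m
  exact hst a v (Submodule.mem_iSup_of_mem lam hw)

lemma sx_gen_vec {lam : Fin n → K} {v : M} (hv : v ≠ 0)
    (hw : v ∈ genWeightSpace K n M lam) : ∃ w : M, w ≠ 0 ∧ w ∈ weightSpace K n M lam := by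
  have key : ∀ s : Finset (Fin n), ∃ w : M, w ≠ 0 ∧ w ∈ genWeightSpace K n M lam ∧
      ∀ i ∈ s, (HEl K n i - algebraMap K (In K n) (lam i)) • w = 0 := by
    intro s
    induction s using Finset.induction_on with
    | empty => exact ⟨v, hv, hw, by simp⟩
    | insert i s _ ih =>
      obtain ⟨w, h0, ⟨N, hN⟩, hs⟩ := ih
      classical
      have hex : ∃ k, ((HEl K n i - algebraMap K (In K n) (lam i)) ^ k) • w = 0 := ⟨N, hN i⟩
      have hcomm : ∀ j k, Commute ((HEl K n j - algebraMap K (In K n) (lam j)))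
          ((HEl K n i - algebraMap K (In K n) (lam i)) ^ k) := by
        intro j k
        refine Commute.pow_right ?_ k
        refine Commute.sub_right (Commute.sub_left (hEl_comm K n j i) ?_) ?_
        · exact Algebra.commutes _ _
        · exact (Algebra.commutes _ _).symm
      obtain ⟨k, hk⟩ : ∃ k, Nat.find hex = k + 1 := by
        refine Nat.exists_eq_succ_of_ne_zero fun h => ?_
        have := Nat.find_spec hex
        rw [h, pow_zero, one_smul] at this
        exact h0 this
      have h1 := Nat.find_spec hex
      rw [hk] at h1
      refine ⟨((HEl K n i - algebraMap K (In K n) (lam i)) ^ k) • w,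
        Nat.find_min hex (by omega), ⟨N, fun j => ?_⟩, ?_⟩
      · rw [← mul_smul, ((hcomm j k).pow_left N).eq, mul_smul, hN, smul_zero]
      · intro j hj
        rcases Finset.mem_insert.mp hj with rfl | hj
        · rw [← mul_smul, ← pow_succ', h1]
        · rw [← mul_smul, (hcomm j k).eq, mul_smul, hs j hj, smul_zero]
  obtain ⟨w, h0, _, h⟩ := key Finset.univ
  refine ⟨w, h0, fun i => ?_⟩
  have := h i (Finset.mem_univ i)
  rwa [sub_smul, algebraMap_smul, sub_eq_zero] at this

lemma sx_part1 (hM : IsSimpleModule (In K n) M) :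
    IsGenWeightModule K n M ↔ IsWeightModule K n M := by
  constructor
  · intro h
    rw [sx_isGen_iff] at h
    have := hM.nontrivial
    have : ∃ lam, genWeightSpace K n M lam ≠ ⊥ := by
      by_contra! hc
      have hnt : Nontrivial M := IsSimpleModule.nontrivial (In K n) M
      simp only [hc, iSup_bot] at h
      exact bot_ne_top h
    obtain ⟨lam, hlam⟩ := this
    obtain ⟨v, hv, h0⟩ := Submodule.exists_mem_ne_zero_of_ne_bot hlam
    obtain ⟨w, hw, h1⟩ := sx_gen_vec h0 hv
    exact sx_weight_of_vec hw h1
  · intro h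
    rw [sx_isWeight_iff] at h
    rw [sx_isGen_iff, eq_top_iff, ← h]
    exact iSup_mono sx_wt_le

/-- A good weight vector. -/
structure SxGood (lam : Fin n → K) (v : M) : Prop where
  ne : v ≠ 0
  wt : v ∈ weightSpace K n M lam
  good : ∀ i, dEl K n i • v ≠ 0 → ∀ k, (sxE K n i * dEl K n i ^ k) • v = 0

lemma sx_exists_good [IsSimpleModule (In K n) M] (h : IsWeightModule K n M) :
    ∃ (lam : Fin n → K) (v : M), SxGood lam v := by
  rw [sx_isWeight_iff] at h
  have : ∃ lam, weightSpace K n M lam ≠ ⊥ := by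
    by_contra! hc
    have hnt : Nontrivial M := IsSimpleModule.nontrivial (In K n) M
    simp only [hc, iSup_bot] at h
    exact bot_ne_top h
  obtain ⟨lam, hlam⟩ := this
  obtain ⟨v, hv, h0⟩ := Submodule.exists_mem_ne_zero_of_ne_bot hlam
  have key : ∀ s : Finset (Fin n), ∃ (mu : Fin n → K) (w : M), w ≠ 0 ∧ w ∈ weightSpace K n M mu ∧
      ∀ i ∈ s, dEl K n i • w ≠ 0 → ∀ k, (sxE K n i * dEl K n i ^ k) • w = 0 := by
    intro s
    induction s using Finset.induction_on with
    | empty => exact ⟨lam, v, h0, hv, by simp⟩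
    | insert i s his ih =>
      obtain ⟨mu, w, hw0, hw, hs⟩ := ih
      by_cases hc : ∀ k, (sxE K n i * dEl K n i ^ k) • w = 0
      · refine ⟨mu, w, hw0, hw, fun j hj => ?_⟩
        rcases Finset.mem_insert.mp hj with rfl | hj
        · exact fun _ => hc
        · exact hs j hj
      · push Not at hc
        obtain ⟨k, hk⟩ := hc
        obtain ⟨nu, hnu⟩ := sx_wt_dpow hw i k
        refine ⟨nu, (sxE K n i * dEl K n i ^ k) • w, hk, ?_, ?_⟩
        · rw [mul_smul]; exact sx_wt_e hnu i
        · intro j hj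
          rcases Finset.mem_insert.mp hj with rfl | hj
          · intro hne
            exact absurd (by rw [← mul_smul, ← mul_assoc, sx_d_e, zero_mul, zero_smul]) hne
          · have hij : i ≠ j := by rintro rfl; exact his hj
            have c1 : Commute (dEl K n j) (sxE K n i * dEl K n i ^ k) :=
              (sx_e_comm_d hij).symm.mul_right ((sx_d_d _ _).pow_right k)
            intro hne l
            have c2 : Commute (sxE K n j * dEl K n j ^ l) (sxE K n i * dEl K n i ^ k) :=
              Commute.mul_left ((sx_e_comm_e _ _).mul_right ((sx_e_comm_d hij.symm).pow_right k))
                (c1.pow_left l)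
            rw [← mul_smul, c2.eq, mul_smul, hs j hj ?_ l, smul_zero]
            intro h0
            apply hne
            rw [← mul_smul, c1.eq, mul_smul, h0, smul_zero]
  obtain ⟨mu, w, a, b, c⟩ := key Finset.univ
  exact ⟨mu, w, a, b, fun i => c i (Finset.mem_univ i)⟩

end Wt

section Prod
variable {A : Type*} [Monoid A] {n : ℕ}

noncomputable def sxHomP (g : Fin n → A) (hg : ∀ i j, Commute (g i) (g j)) :
    (Fin n → Multiplicative ℕ) →* A :=
  MonoidHom.noncommPiCoprod (fun i => powersHom A (g i))
    (fun i j _ x y => by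
      simp only [powersHom_apply]
      exact (hg i j).pow_pow _ _)

noncomputable def sxP (g : Fin n → A) (hg : ∀ i j, Commute (g i) (g j)) (k : Fin n → ℕ) : A :=
  sxHomP g hg (fun i => Multiplicative.ofAdd (k i))

variable (g : Fin n → A) (hg : ∀ i j, Commute (g i) (g j))

lemma sxP_zero : sxP g hg 0 = 1 := map_one (sxHomP g hg)

lemma sxP_add (k l : Fin n → ℕ) : sxP g hg (k + l) = sxP g hg k * sxP g hg l :=
  map_mul (sxHomP g hg) (fun i => Multiplicative.ofAdd (k i)) (fun i => Multiplicative.ofAdd (l i))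

lemma sxP_single (i : Fin n) (m : ℕ) : sxP g hg (Pi.single i m) = g i ^ m := by
  have := MonoidHom.noncommPiCoprod_mulSingle (ϕ := fun i => powersHom A (g i))
    (hcomm := fun i j _ x y => by
      simp only [powersHom_apply]
      exact (hg i j).pow_pow _ _) i (Multiplicative.ofAdd m)
  simp only [powersHom_apply, toAdd_ofAdd] at this
  rw [← this]
  have h2 : (fun j => Multiplicative.ofAdd ((Pi.single i m : Fin n → ℕ) j))
      = Pi.mulSingle i (Multiplicative.ofAdd m) := by
    funext j
    by_cases h : j = i
    · subst h; simp
    · simp [h]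
  exact congrArg (sxHomP g hg) h2

lemma sxP_commute (a : A) (k : Fin n → ℕ) (h : ∀ j, k j ≠ 0 → Commute a (g j)) :
    Commute a (sxP g hg k) := by
  have e : sxP g hg k = _ := MonoidHom.noncommPiCoprod_apply (fun i => powersHom A (g i))
    (hcomm := fun i j _ x y => by
      simp only [powersHom_apply]
      exact (hg i j).pow_pow _ _) (fun i => Multiplicative.ofAdd (k i))
  rw [e]
  apply Finset.noncommProd_induction
  · exact fun x y ↦ Commute.mul_right
  · exact Commute.one_right _
  · intro j _
    simp only [powersHom_apply, toAdd_ofAdd]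
    by_cases hj : k j = 0
    · rw [hj, pow_zero]; exact Commute.one_right _
    · exact (h j hj).pow_right _

lemma sx_pi_induct (p : (Fin n → ℕ) → Prop) (h0 : p 0)
    (hs : ∀ k i, p k → p (k + Pi.single i 1)) (k : Fin n → ℕ) : p k := by
  induction hN : ∑ i, k i generalizing k with
  | zero =>
    have : k = 0 := by
      funext i
      simpa using (Finset.sum_eq_zero_iff.mp hN) i (Finset.mem_univ i)
    rw [this]; exact h0
  | succ N ih =>
    have : ∃ i, k i ≠ 0 := by
      by_contra! hc
      simp [hc] at hN
    obtain ⟨i, hi⟩ := this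
    have hk : k = (k - Pi.single i 1) + Pi.single i 1 := by
      funext j
      by_cases h : j = i
      · subst h; simp; omega
      · simp [h]
    rw [hk]
    apply hs
    apply ih
    have h2 : ∑ j, k j = ∑ j, (k - Pi.single i 1 : Fin n → ℕ) j + ∑ j, (Pi.single i 1 : Fin n → ℕ) j := by
      conv_lhs => rw [hk]
      rw [← Finset.sum_add_distrib]; rfl
    simp only [Finset.sum_pi_single', Finset.mem_univ, if_true] at h2
    omega
end Prod

abbrev SxIdx (p : Prop) := {z : ℤ // p → 0 ≤ z}

def SxIdx.succ {p : Prop} (z : SxIdx p) : SxIdx p := ⟨z.1 + 1, fun h => by have := z.2 h; omega⟩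

section Basis
variable {K : Type*} [Field K] [CharZero K] {n : ℕ}
variable {M : Type*} [AddCommGroup M] [Module K M] [Module (In K n) M] [IsScalarTower K (In K n) M]

noncomputable def sxPI (K : Type*) [Field K] [CharZero K] (n : ℕ) (k : Fin n → ℕ) : In K n :=
  sxP (intEl K n) sx_int_int k
noncomputable def sxPD (K : Type*) [Field K] [CharZero K] (n : ℕ) (k : Fin n → ℕ) : In K n :=
  sxP (dEl K n) sx_d_d k

noncomputable def sxB (K : Type*) [Field K] [CharZero K] {n : ℕ}
    {M : Type*} [AddCommGroup M] [Module (In K n) M] (v : M) (k : Fin n → ℤ) : M :=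
  sxPI K n (fun i => (k i).toNat) • sxPD K n (fun i => (-k i).toNat) • v

lemma sxPI_zero : sxPI K n 0 = 1 := sxP_zero _ _
lemma sxPD_zero : sxPD K n 0 = 1 := sxP_zero _ _
lemma sxPI_add (k l : Fin n → ℕ) : sxPI K n (k + l) = sxPI K n k * sxPI K n l := sxP_add _ _ _ _
lemma sxPD_add (k l : Fin n → ℕ) : sxPD K n (k + l) = sxPD K n k * sxPD K n l := sxP_add _ _ _ _
lemma sxPI_single (i : Fin n) (m : ℕ) : sxPI K n (Pi.single i m) = intEl K n i ^ m :=
  sxP_single _ _ _ _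
lemma sxPD_single (i : Fin n) (m : ℕ) : sxPD K n (Pi.single i m) = dEl K n i ^ m :=
  sxP_single _ _ _ _
lemma sxPI_commute (a : In K n) (k : Fin n → ℕ) (h : ∀ j, k j ≠ 0 → Commute a (intEl K n j)) :
    Commute a (sxPI K n k) := sxP_commute _ _ _ _ h
lemma sxPD_commute (a : In K n) (k : Fin n → ℕ) (h : ∀ j, k j ≠ 0 → Commute a (dEl K n j)) :
    Commute a (sxPD K n k) := sxP_commute _ _ _ _ h

lemma sxPI_succ (k : Fin n → ℕ) (i : Fin n) :
    sxPI K n (k + Pi.single i 1) = intEl K n i * sxPI K n k := by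
  rw [add_comm, sxPI_add, sxPI_single, pow_one]
lemma sxPD_succ (k : Fin n → ℕ) (i : Fin n) :
    sxPD K n (k + Pi.single i 1) = dEl K n i * sxPD K n k := by
  rw [add_comm, sxPD_add, sxPD_single, pow_one]

lemma sxPD_PI (k : Fin n → ℕ) : sxPD K n k * sxPI K n k = 1 := by
  induction k using sx_pi_induct with
  | h0 => rw [sxPI_zero, sxPD_zero, mul_one]
  | hs k i ih =>
    rw [sxPI_succ, sxPD_add, sxPD_single, pow_one, mul_assoc,
      ← mul_assoc (dEl K n i), sx_d_int, one_mul, ih]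

lemma sxPI_wt (k : Fin n → ℕ) {lam : Fin n → K} {m : M} (hm : m ∈ weightSpace K n M lam) :
    sxPI K n k • m ∈ weightSpace K n M (fun i => lam i + k i) := by
  induction k using sx_pi_induct with
  | h0 => rw [sxPI_zero, one_smul]; simpa using hm
  | hs k i ih =>
    rw [sxPI_succ, mul_smul]
    convert sx_wt_int ih i using 2
    funext j
    by_cases h : j = i
    · subst h; simp; ring
    · simp [h]

lemma sxPD_wt (k : Fin n → ℕ) {lam : Fin n → K} {m : M} (hm : m ∈ weightSpace K n M lam) :
    sxPD K n k • m ∈ weightSpace K n M (fun i => lam i - k i) := by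
  induction k using sx_pi_induct with
  | h0 => rw [sxPD_zero, one_smul]; simpa using hm
  | hs k i ih =>
    rw [sxPD_succ, mul_smul]
    convert sx_wt_d ih i using 2
    funext j
    by_cases h : j = i
    · subst h; simp; ring
    · simp [h]

lemma sx_split (k : Fin n → ℕ) (i : Fin n) :
    k = Function.update k i 0 + Pi.single i (k i) := by
  funext j
  by_cases h : j = i
  · subst h; simp
  · simp [h]

lemma sx_kill {lam : Fin n → K} {v : M} (hg : SxGood lam v) (i : Fin n) (hi : dEl K n i • v ≠ 0)
    (k : Fin n → ℕ) : sxE K n i • sxPD K n k • v = 0 := by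
  rw [sx_split k i, sxPD_add, sxPD_single, ← mul_smul, ← mul_assoc,
    (sxPD_commute (sxE K n i) (Function.update k i 0) ?_).eq, mul_assoc, mul_smul,
    hg.good i hi, smul_zero]
  intro j hj
  by_cases h : j = i
  · subst h; simp at hj
  · exact sx_e_comm_d (Ne.symm h)

lemma sx_int_d_kill {lam : Fin n → K} {v : M} (hg : SxGood lam v) (i : Fin n)
    (hi : dEl K n i • v ≠ 0) (k : Fin n → ℕ) :
    intEl K n i • dEl K n i • sxPD K n k • v = sxPD K n k • v := by
  have := sx_kill hg i hi k
  rw [sxE, sub_smul, one_smul, mul_smul, sub_eq_zero] at this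
  exact this.symm

lemma sxPD_ne {lam : Fin n → K} {v : M} (hg : SxGood lam v) (k : Fin n → ℕ)
    (hk : ∀ i, dEl K n i • v = 0 → k i = 0) : sxPD K n k • v ≠ 0 := by
  induction k using sx_pi_induct with
  | h0 => rw [sxPD_zero, one_smul]; exact hg.ne
  | hs k i ih =>
    have hi : dEl K n i • v ≠ 0 := fun h => by simpa using hk i h
    intro h0
    rw [sxPD_succ, mul_smul] at h0
    refine ih (fun j hj => ?_) ?_
    · have := hk j hj
      simp at this; exact this.1
    · rw [← sx_int_d_kill hg i hi k, h0, smul_zero]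

lemma sxB_ne {lam : Fin n → K} {v : M} (hg : SxGood lam v) (k : Fin n → ℤ)
    (hk : ∀ i, dEl K n i • v = 0 → 0 ≤ k i) : sxB K v k ≠ 0 := by
  intro h
  refine sxPD_ne hg (fun i => (-k i).toNat) (fun i hi => ?_) ?_
  · have := hk i hi
    simp [this]
  · have h2 := congrArg (fun m => sxPD K n (fun i => (k i).toNat) • m) h
    simp only [sxB, smul_zero] at h2
    rwa [← mul_smul, sxPD_PI, one_smul] at h2

lemma sxB_wt {lam : Fin n → K} {v : M} (hg : SxGood lam v) (k : Fin n → ℤ) :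
    sxB K v k ∈ weightSpace K n M (fun i => lam i + k i) := by
  unfold sxB
  convert sxPI_wt (fun i => (k i).toNat) (sxPD_wt (fun i => (-k i).toNat) hg.wt) using 2
  funext i
  have : ((k i : ℤ) : K) = (((k i).toNat : ℤ) : K) - (((-k i).toNat : ℤ) : K) := by
    rw [← Int.cast_sub]; congr 1; omega
  rw [this]; push_cast; ring

lemma sx_up_add (f g : Fin n → ℕ) (i : Fin n) (h : ∀ j, j ≠ i → f j = g j) (hi : f i = g i + 1) :
    f = g + Pi.single i 1 := by
  funext j
  by_cases hj : j = i
  · subst hj; simp [hi]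
  · simp [hj, h j hj]

lemma sx_comm_d_PI (k : Fin n → ℕ) (i : Fin n) (h : k i = 0) :
    Commute (dEl K n i) (sxPI K n k) := by
  refine sxPI_commute _ _ fun j hj => sx_d_int_ne ?_
  rintro rfl; exact hj h

lemma sxB_int {lam : Fin n → K} {v : M} (hg : SxGood lam v) (k : Fin n → ℤ) (i : Fin n)
    (hk : dEl K n i • v = 0 → 0 ≤ k i) :
    intEl K n i • sxB K v k = sxB K v (Function.update k i (k i + 1)) := by
  by_cases h : 0 ≤ k i
  · unfold sxB
    rw [sx_up_add (fun j => ((Function.update k i (k i + 1)) j).toNat) (fun j => (k j).toNat) i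
      (by intro j hj; simp [hj]) (by simp; omega), sxPI_succ, mul_smul]
    congr 4
    funext j
    by_cases hj : j = i
    · subst hj; simp; omega
    · simp [hj]
  · unfold sxB
    rw [sx_up_add (fun j => (- k j).toNat) (fun j => (-(Function.update k i (k i + 1)) j).toNat) i
      (by intro j hj; simp [hj]) (by simp; omega), sxPD_succ, mul_smul, ← mul_smul,
      (sxPI_commute (intEl K n i) _ (fun j _ => sx_int_int _ _)).eq, mul_smul,
      sx_int_d_kill hg i (fun h' => h (hk h'))]
    congr 2
    funext j
    by_cases hj : j = i
    · subst hj; simp; omega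
    · simp [hj]

lemma sxB_d (v : M) (k : Fin n → ℤ) (i : Fin n) :
    dEl K n i • sxB K v k = sxB K v (Function.update k i (k i - 1)) := by
  by_cases h : 0 < k i
  · unfold sxB
    rw [sx_up_add (fun j => (k j).toNat) (fun j => ((Function.update k i (k i - 1)) j).toNat) i
      (by intro j hj; simp [hj]) (by simp; omega), sxPI_succ, ← mul_smul, ← mul_assoc, sx_d_int,
      one_mul]
    congr 3
    funext j
    by_cases hj : j = i
    · subst hj; simp; omega
    · simp [hj]
  · unfold sxB
    rw [sx_up_add (fun j => (-(Function.update k i (k i - 1)) j).toNat) (fun j => (- k j).toNat) i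
      (by intro j hj; simp [hj]) (by simp; omega), sxPD_succ, ← mul_smul,
      (sx_comm_d_PI (K := K) (fun j => (k j).toNat) i (by simp; omega)).eq, mul_smul,
      mul_smul]
    congr 2
    funext j
    by_cases hj : j = i
    · subst hj; simp; omega
    · simp [hj]

lemma sxB_zero (v : M) (k : Fin n → ℤ) (i : Fin n) (hi : k i < 0) (hv : dEl K n i • v = 0) :
    sxB K v k = 0 := by
  unfold sxB
  rw [sx_up_add (fun j => (-k j).toNat) (fun j => (-(Function.update k i (k i + 1)) j).toNat) i
      (by intro j hj; simp [hj]) (by simp; omega), sxPD_add, sxPD_single, pow_one, mul_smul, hv,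
      smul_zero, smul_zero]

/-- Standard basis data. -/
structure SxData (p : Fin n → Prop) (lam : Fin n → K) (b : Module.Basis (∀ i, SxIdx (p i)) K M) :
    Prop where
  H : ∀ κ i, HEl K n i • b κ = (lam i + (κ i).1) • b κ
  int : ∀ κ i, intEl K n i • b κ = b (Function.update κ i (κ i).succ)
  d_pos : ∀ κ i (h : p i → 0 ≤ (κ i).1 - 1),
    dEl K n i • b κ = b (Function.update κ i ⟨(κ i).1 - 1, h⟩)
  d_zero : ∀ κ i, ¬ (p i → 0 ≤ (κ i).1 - 1) → dEl K n i • b κ = 0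

lemma sx_upd_val {p : Fin n → Prop} (κ : ∀ i, SxIdx (p i)) (i : Fin n) (z : SxIdx (p i)) :
    (fun j => (Function.update κ i z j).1) = Function.update (fun j => (κ j).1) i z.1 := by
  funext j
  by_cases h : j = i
  · subst h; simp
  · simp [h]

theorem sx_basis {lam : Fin n → K} {v : M} (hg : SxGood lam v)
    (hgen : ∀ m : M, ∃ a : In K n, a • v = m) (p : Fin n → Prop)
    (hp : ∀ i, p i ↔ dEl K n i • v = 0) :
    ∃ b : Module.Basis (∀ i, SxIdx (p i)) K M, SxData p lam b := by
  let f : (∀ i, SxIdx (p i)) → M := fun κ => sxB K v (fun i => (κ i).1)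
  have hH : ∀ κ i, HEl K n i • f κ = (lam i + (κ i).1) • f κ := fun κ i => sxB_wt hg _ i
  have hint : ∀ κ i, intEl K n i • f κ = f (Function.update κ i (κ i).succ) := by
    intro κ i
    simp only [f]
    rw [sx_upd_val, sxB_int hg _ i (fun h => (κ i).2 ((hp i).2 h))]; rfl
  have hd1 : ∀ κ i (h : p i → 0 ≤ (κ i).1 - 1),
      dEl K n i • f κ = f (Function.update κ i ⟨(κ i).1 - 1, h⟩) := by
    intro κ i h
    simp only [f]
    rw [sx_upd_val, sxB_d]
  have hd0 : ∀ κ i, ¬ (p i → 0 ≤ (κ i).1 - 1) → dEl K n i • f κ = 0 := by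
    intro κ i h
    simp only [f]
    push Not at h
    rw [sxB_d]
    exact sxB_zero v _ i (by simpa using h.2) ((hp i).1 h.1)
  have hli : LinearIndependent K f := by
    have hinj : Function.Injective
        (fun (κ : ∀ i, SxIdx (p i)) (i : Fin n) => lam i + (((κ i).1 : ℤ) : K)) := by
      intro κ κ' h
      funext i
      have := congrFun h i
      simpa [Subtype.ext_iff] using this
    exact (sx_wt_indep (M := M).comp hinj).linearIndependent _ (fun κ => sxB_wt hg _)
      (fun κ => sxB_ne hg _ (fun i hi => (κ i).2 ((hp i).2 hi)))
  have hst : ∀ (a : In K n), (∀ κ, a • f κ ∈ Submodule.span K (Set.range f)) →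
      ∀ m ∈ Submodule.span K (Set.range f), a • m ∈ Submodule.span K (Set.range f) := by
    intro a ha
    have : Submodule.span K (Set.range f)
        ≤ (Submodule.span K (Set.range f)).comap (Algebra.lsmul K K M a) := by
      rw [Submodule.span_le]
      rintro _ ⟨κ, rfl⟩
      exact ha κ
    exact fun m hm => this hm
  have hmem : ∀ κ, f κ ∈ Submodule.span K (Set.range f) := fun κ => Submodule.subset_span ⟨κ, rfl⟩
  have hsp : ⊤ ≤ Submodule.span K (Set.range f) := by
    intro m _
    obtain ⟨a, rfl⟩ := hgen m
    refine sx_stable _ (fun i => hst _ fun κ => ?_) (fun i => hst _ fun κ => ?_)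
      (fun i => hst _ fun κ => ?_) a v ?_
    · rw [← sx_int_H, mul_smul, hH, ← smul_comm _ (intEl K n i), hint]
      exact Submodule.smul_mem _ _ (hmem _)
    · by_cases h : p i → 0 ≤ (κ i).1 - 1
      · rw [hd1 κ i h]; exact hmem _
      · rw [hd0 κ i h]; exact Submodule.zero_mem _
    · rw [hint]; exact hmem _
    · have h0 : f (fun i => ⟨0, fun _ => le_refl _⟩) = v := by
        simp only [f, sxB, neg_zero, Int.toNat_zero]
        change sxPI K n 0 • sxPD K n 0 • v = v
        rw [sxPI_zero, sxPD_zero, one_smul, one_smul]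
      rw [← h0]; exact hmem _
  refine ⟨Module.Basis.mk hli hsp, ?_, ?_, ?_, ?_⟩
  · intro κ i; rw [Module.Basis.mk_apply]; exact hH κ i
  · intro κ i; rw [Module.Basis.mk_apply, Module.Basis.mk_apply]; exact hint κ i
  · intro κ i h; rw [Module.Basis.mk_apply, Module.Basis.mk_apply]; exact hd1 κ i h
  · intro κ i h; rw [Module.Basis.mk_apply]; exact hd0 κ i h

end Basis

section One
variable {K : Type*} [Field K] [CharZero K]
variable {N : Type*} [AddCommGroup N] [Module K N] [Module (In K 1) N] [IsScalarTower K (In K 1) N]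

structure SxData1 (q : Prop) (lam : K) (c : Module.Basis (SxIdx q) K N) : Prop where
  H : ∀ z, HEl K 1 0 • c z = (lam + z.1) • c z
  int : ∀ z, intEl K 1 0 • c z = c z.succ
  d_pos : ∀ (z : SxIdx q) (h : q → 0 ≤ z.1 - 1), dEl K 1 0 • c z = c ⟨z.1 - 1, h⟩
  d_zero : ∀ z : SxIdx q, ¬ (q → 0 ≤ z.1 - 1) → dEl K 1 0 • c z = 0

lemma sx_data1 {lam : K} {v : N} (hg : SxGood (n := 1) (fun _ => lam) v)
    (hgen : ∀ m : N, ∃ a : In K 1, a • v = m) (q : Prop) (hq : q ↔ dEl K 1 0 • v = 0) :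
    ∃ c : Module.Basis (SxIdx q) K N, SxData1 q lam c := by
  obtain ⟨b, hb⟩ := sx_basis hg hgen (fun _ => q) (fun i => by rw [Subsingleton.elim i 0]; exact hq)
  have hc : ∀ z, (b.reindex (Equiv.funUnique (Fin 1) (SxIdx q))) z = b (fun _ => z) := by
    intro z
    rw [Module.Basis.reindex_apply]; rfl
  have hu : ∀ z z' : SxIdx q, Function.update (fun _ : Fin 1 => z) 0 z' = fun _ => z' := by
    intro z z'
    funext j
    rw [Subsingleton.elim j 0]; simp
  refine ⟨b.reindex (Equiv.funUnique (Fin 1) (SxIdx q)), ?_, ?_, ?_, ?_⟩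
  · intro z; rw [hc]; exact hb.H _ 0
  · intro z; rw [hc, hc, hb.int]; exact congrArg b (hu _ _)
  · intro z h; rw [hc, hc, hb.d_pos _ 0 h]; exact congrArg b (hu _ _)
  · intro z h; rw [hc]; exact hb.d_zero _ 0 h

lemma sx_one_weight {q : Prop} {lam : K} {c : Module.Basis (SxIdx q) K N} (hc : SxData1 q lam c) :
    IsWeightModule K 1 N := by
  rw [sx_isWeight_iff, eq_top_iff, ← c.span_eq, Submodule.span_le]
  rintro _ ⟨z, rfl⟩
  refine Submodule.mem_iSup_of_mem (fun _ => lam + z.1) ?_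
  intro i
  rw [Subsingleton.elim i 0]
  exact hc.H z

lemma sx_aeval {q : Prop} {lam : K} {c : Module.Basis (SxIdx q) K N} (hc : SxData1 q lam c)
    (f : Polynomial K) (z : SxIdx q) :
    (Polynomial.aeval (HEl K 1 0) f) • c z = (f.eval (lam + z.1)) • c z := by
  induction f using Polynomial.induction_on' with
  | add f g hf hg => rw [map_add, add_smul, hf, hg, Polynomial.eval_add, add_smul]
  | monomial k a =>
    have hp : (HEl K 1 0 ^ k) • c z = ((lam + z.1) ^ k) • c z := by
      induction k with
      | zero => simp
      | succ k ih =>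
        rw [pow_succ', mul_smul, ih, ← smul_comm _ (HEl K 1 0), hc.H, smul_smul, pow_succ]
    rw [Polynomial.aeval_monomial, mul_smul, hp, algebraMap_smul, smul_smul,
      Polynomial.eval_monomial]

lemma sx_one_simple {q : Prop} {lam : K} {c : Module.Basis (SxIdx q) K N} (hc : SxData1 q lam c) :
    IsSimpleModule (In K 1) N := by
  rw [isSimpleModule_iff_toSpanSingleton_surjective]
  refine ⟨⟨c ⟨0, fun _ => le_refl _⟩, 0, c.ne_zero _⟩, fun w hw => ?_⟩
  set W : Submodule (In K 1) N := LinearMap.range (LinearMap.toSpanSingleton (In K 1) N w) with hW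
  have hwW : w ∈ W := ⟨1, by simp⟩
  have hup : ∀ (k : ℕ) (z z' : SxIdx q), z'.1 = z.1 + k → c z ∈ W → c z' ∈ W := by
    intro k
    induction k with
    | zero =>
      intro z z' h hz
      have : z' = z := Subtype.ext (by simpa using h)
      rwa [this]
    | succ k ih =>
      intro z z' h hz
      refine ih z.succ z' (by simp only [SxIdx.succ]; push_cast at h; omega) ?_
      rw [← hc.int]; exact W.smul_mem _ hz
  have hdn : ∀ (k : ℕ) (z z' : SxIdx q), z'.1 = z.1 - k → c z ∈ W → c z' ∈ W := by
    intro k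
    induction k with
    | zero =>
      intro z z' h hz
      have : z' = z := Subtype.ext (by simpa using h)
      rwa [this]
    | succ k ih =>
      intro z z' h hz
      have hq : q → 0 ≤ z.1 - 1 := fun hq => by have := z'.2 hq; push_cast at h; omega
      refine ih ⟨z.1 - 1, hq⟩ z' (by push_cast at h; simp only; omega) ?_
      rw [← hc.d_pos]; exact W.smul_mem _ hz
  have hall : ∀ z z' : SxIdx q, c z ∈ W → c z' ∈ W := by
    intro z z' hz
    rcases le_total z.1 z'.1 with h | h
    · exact hup (z'.1 - z.1).toNat z z' (by omega) hz
    · exact hdn (z.1 - z'.1).toNat z z' (by omega) hz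
  have hKmem : ∀ (a : K) (m : N), m ∈ W → a • m ∈ W := by
    intro a m hm
    rw [← algebraMap_smul (In K 1) a m]; exact W.smul_mem _ hm
  obtain ⟨z, hz⟩ : ∃ z, c.repr w z ≠ 0 := by
    by_contra! h
    exact hw (c.repr.map_eq_zero_iff.mp (Finsupp.ext h))
  have hzW : c z ∈ W := by
    classical
    let f : Polynomial K := ∏ j ∈ (c.repr w).support.erase z,
      (Polynomial.X - Polynomial.C (lam + (j.1 : K)))
    have hf0 : f.eval (lam + z.1) ≠ 0 := by
      simp only [f, Polynomial.eval_prod, Finset.prod_ne_zero_iff]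
      intro j hj
      have hne : j ≠ z := Finset.ne_of_mem_erase hj
      simp only [Polynomial.eval_sub, Polynomial.eval_X, Polynomial.eval_C]
      rw [sub_ne_zero]
      intro h
      apply hne
      have h := add_left_cancel h
      exact Subtype.ext (Int.cast_injective h).symm
    have hfj : ∀ j ∈ (c.repr w).support, j ≠ z → f.eval (lam + j.1) = 0 := by
      intro j hj hjz
      simp only [f, Polynomial.eval_prod]
      exact Finset.prod_eq_zero (Finset.mem_erase.mpr ⟨hjz, hj⟩) (by simp)
    have hs : (Polynomial.aeval (HEl K 1 0) f) • w = (c.repr w z * f.eval (lam + z.1)) • c z := by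
      conv_lhs => rw [← c.linearCombination_repr w, Finsupp.linearCombination_apply, Finsupp.sum,
        Finset.smul_sum]
      rw [Finset.sum_eq_single z]
      · rw [← smul_comm (c.repr w z), sx_aeval hc, smul_smul]
      · intro j hj hjz
        rw [← smul_comm (c.repr w j), sx_aeval hc, hfj j hj hjz, zero_smul, smul_zero]
      · intro h; exact absurd (Finsupp.notMem_support_iff.mp h) hz
    have h1 : (c.repr w z * f.eval (lam + z.1)) • c z ∈ W := by
      rw [← hs]; exact W.smul_mem _ hwW
    have h2 := hKmem (c.repr w z * f.eval (lam + z.1))⁻¹ _ h1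
    rwa [smul_smul, inv_mul_cancel₀ (mul_ne_zero hz hf0), one_smul] at h2
  rw [← LinearMap.range_eq_top, ← hW, eq_top_iff]
  intro m _
  rw [← c.linearCombination_repr m, Finsupp.linearCombination_apply, Finsupp.sum]
  exact W.sum_mem fun j _ => hKmem _ _ (hall z j hzW)

end One

section Tensor
universe u
variable {K : Type u} [Field K] [CharZero K] {n : ℕ}

lemma sx_tprodMap (Mi : Fin n → ModN K 1) (i : Fin n) (a : In K 1) (m : ∀ j, (Mi j).carrier) :
    tprodMap K n Mi i a (PiTensorProduct.tprod K m)
      = PiTensorProduct.tprod K (Function.update m i (a • m i)) := by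
  rw [tprodMap, PiTensorProduct.map_tprod]
  congr 1
  funext j
  by_cases h : j = i
  · subst h; simp; rfl
  · simp [h]

variable {M : Type*} [AddCommGroup M] [Module K M] [Module (In K n) M] [IsScalarTower K (In K n) M]

def sxJ (K : Type u) [Field K] [CharZero K] {n : ℕ} {M : Type*} [AddCommGroup M]
    [Module (In K n) M] (v : M) (i : Fin n) : Submodule (In K 1) (In K 1) where
  carrier := {a | sxIota K n i a • v = 0}
  add_mem' := by
    intro a b ha hb
    change sxIota K n i (a + b) • v = 0
    rw [map_add, add_smul, ha, hb, add_zero]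
  zero_mem' := by
    change sxIota K n i 0 • v = 0
    rw [map_zero, zero_smul]
  smul_mem' := by
    intro c a ha
    change sxIota K n i (c * a) • v = 0
    rw [map_mul, mul_smul, ha, smul_zero]

noncomputable def sxMod (K : Type u) [Field K] [CharZero K] {n : ℕ} {M : Type*} [AddCommGroup M]
    [Module (In K n) M] (v : M) (i : Fin n) : ModN K 1 :=
  { carrier := In K 1 ⧸ sxJ K v i }

noncomputable def sxV (K : Type u) [Field K] [CharZero K] {n : ℕ} {M : Type*} [AddCommGroup M]
    [Module (In K n) M] (v : M) (i : Fin n) : (sxMod K v i).carrier :=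
  (Submodule.Quotient.mk (1 : In K 1) : In K 1 ⧸ sxJ K v i)

lemma sxV_gen (v : M) (i : Fin n) (m : (sxMod K v i).carrier) :
    ∃ a : In K 1, a • sxV K v i = m := by
  obtain ⟨a, ha⟩ := Submodule.Quotient.mk_surjective (sxJ K v i) m
  refine ⟨a, Eq.trans ?_ ha⟩
  change (Submodule.Quotient.mk (a • (1 : In K 1)) : In K 1 ⧸ sxJ K v i) = _
  rw [smul_eq_mul, mul_one]

lemma sxV_zero (v : M) (i : Fin n) (a : In K 1) :
    a • sxV K v i = 0 ↔ sxIota K n i a • v = 0 := by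
  change (Submodule.Quotient.mk (a • (1 : In K 1)) : In K 1 ⧸ sxJ K v i) = 0 ↔ _
  rw [smul_eq_mul, mul_one, Submodule.Quotient.mk_eq_zero]
  rfl

lemma sxV_good {lam : Fin n → K} {v : M} (hg : SxGood lam v) (i : Fin n) :
    SxGood (n := 1) (fun _ => lam i) (sxV K v i) := by
  refine ⟨?_, ?_, ?_⟩
  · intro h
    have := (sxV_zero v i 1).1 (by rw [h, smul_zero])
    rw [map_one, one_smul] at this
    exact hg.ne this
  · intro j
    rw [Subsingleton.elim j 0]
    have := (sxV_zero v i (HEl K 1 0 - algebraMap K _ (lam i))).2 (by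
      rw [map_sub, sxIota_H, AlgHom.commutes, sub_smul, algebraMap_smul, hg.wt i, sub_self])
    rwa [sub_smul, sub_eq_zero, algebraMap_smul] at this
  · intro j hj k
    rw [Subsingleton.elim j 0] at hj ⊢
    rw [Ne, sxV_zero, sxIota_d] at hj
    rw [sxV_zero, map_mul, map_pow, sxIota_e, sxIota_d]
    exact hg.good i hj k

theorem sx_part2 (hM : IsSimpleModule (In K n) M) (hw : IsWeightModule K n M) :
    ∃ Mi : Fin n → ModN K 1,
        (∀ i, IsSimpleModule (In K 1) (Mi i).carrier ∧ IsWeightModule K 1 (Mi i).carrier) ∧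
        RealizesTensor K n Mi M := by
  obtain ⟨lam, v, hg⟩ := sx_exists_good hw
  let p : Fin n → Prop := fun i => dEl K n i • v = 0
  obtain ⟨b, hb⟩ := sx_basis hg (IsSimpleModule.toSpanSingleton_surjective (In K n) hg.ne) p
    (fun i => Iff.rfl)
  have hex : ∀ i, ∃ c : Module.Basis (SxIdx (p i)) K (sxMod K v i).carrier,
      SxData1 (p i) (lam i) c := fun i =>
    sx_data1 (sxV_good hg i) (sxV_gen v i) (p i) (by rw [sxV_zero, sxIota_d])
  choose c hc using hex
  refine ⟨sxMod K v, fun i => ⟨sx_one_simple (hc i), sx_one_weight (hc i)⟩, ?_⟩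
  let T : Module.Basis (∀ i, SxIdx (p i)) K (⨂[K] j, (sxMod K v j).carrier) :=
    Basis.piTensorProduct c
  have hT : ∀ κ, T κ = PiTensorProduct.tprod K (fun j => c j (κ j)) :=
    fun κ => Basis.piTensorProduct_apply c κ
  have hTu : ∀ κ i (z : SxIdx (p i)), T (Function.update κ i z)
      = PiTensorProduct.tprod K (Function.update (fun j => c j (κ j)) i (c i z)) := by
    intro κ i z
    rw [hT]
    congr 1
    funext j
    by_cases h : j = i
    · subst h; simp
    · simp [h]
  let φ : M ≃ₗ[K] ⨂[K] j, (sxMod K v j).carrier := b.equiv T (Equiv.refl _)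
  have hφ : ∀ κ, φ (b κ) = T κ := fun κ => by simp [φ]
  have ext : ∀ (a : In K n) (f : (⨂[K] j, (sxMod K v j).carrier) →ₗ[K] _),
      (∀ κ, φ (a • b κ) = f (T κ)) → ∀ m, φ (a • m) = f (φ m) := by
    intro a f h m
    have : φ.toLinearMap ∘ₗ (Algebra.lsmul K K M a) = f ∘ₗ φ.toLinearMap := by
      refine b.ext fun κ => ?_
      have := h κ
      rw [← hφ] at this
      exact this
    exact LinearMap.congr_fun this m
  have hint : ∀ i κ, φ (intEl K n i • b κ) = tprodMap K n (sxMod K v) i (intEl K 1 0) (T κ) := by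
    intro i κ
    rw [hb.int, hφ, hTu, hT, sx_tprodMap, (hc i).int]
  refine ⟨φ, fun i m => ⟨ext _ _ (fun κ => ?_) m, ext _ _ (fun κ => ?_) m, ext _ _ (hint i) m⟩⟩
  · rw [← sx_int_H, mul_smul, hb.H, ← smul_comm _ (intEl K n i), map_smul, hint, hT, sx_tprodMap,
      sx_tprodMap, ← sx_int_H, mul_smul, (hc i).H, ← smul_comm _ (intEl K 1 0),
      MultilinearMap.map_update_smul]
  · by_cases h : p i → 0 ≤ (κ i).1 - 1
    · rw [hb.d_pos κ i h, hφ, hTu, hT, sx_tprodMap, (hc i).d_pos _ h]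
    · rw [hb.d_zero κ i h, map_zero, hT, sx_tprodMap, (hc i).d_zero _ h,
        MultilinearMap.map_update_zero]

/-- slice map -/
noncomputable def sxSliceM (Mi : Fin n → ModN K 1) (i : Fin n)
    (l : ∀ j, (Mi j).carrier →ₗ[K] K) : MultilinearMap K (fun j => (Mi j).carrier) (Mi i).carrier :=
  MultilinearMap.mk' (fun m => (∏ j ∈ Finset.univ.erase i, l j (m j)) • m i)
    (by
      intro m k x y
      by_cases hk : k = i
      · subst hk
        have e : ∀ w, ∏ j ∈ Finset.univ.erase k, l j (Function.update m k w j)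
            = ∏ j ∈ Finset.univ.erase k, l j (m j) := fun w =>
          Finset.prod_congr rfl fun j hj => by
            rw [Function.update_of_ne (Finset.ne_of_mem_erase hj)]
        rw [e, e, e]; simp
      · have hm : k ∈ Finset.univ.erase i := Finset.mem_erase.mpr ⟨hk, Finset.mem_univ _⟩
        have e : ∀ w, ∏ j ∈ Finset.univ.erase i, l j (Function.update m k w j)
            = l k w * ∏ j ∈ (Finset.univ.erase i).erase k, l j (m j) := fun w => by
          rw [← Finset.mul_prod_erase _ _ hm, Function.update_self]
          congr 1
          exact Finset.prod_congr rfl fun j hj => by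
            rw [Function.update_of_ne (Finset.ne_of_mem_erase hj)]
        rw [e, e, e, map_add, add_mul, add_smul]
        simp only [Function.update_of_ne (Ne.symm hk)])
    (by
      intro m k x y
      by_cases hk : k = i
      · subst hk
        have e : ∀ w, ∏ j ∈ Finset.univ.erase k, l j (Function.update m k w j)
            = ∏ j ∈ Finset.univ.erase k, l j (m j) := fun w =>
          Finset.prod_congr rfl fun j hj => by
            rw [Function.update_of_ne (Finset.ne_of_mem_erase hj)]
        rw [e, e, Function.update_self, Function.update_self, smul_comm]
      · have hm : k ∈ Finset.univ.erase i := Finset.mem_erase.mpr ⟨hk, Finset.mem_univ _⟩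
        have e : ∀ w, ∏ j ∈ Finset.univ.erase i, l j (Function.update m k w j)
            = l k w * ∏ j ∈ (Finset.univ.erase i).erase k, l j (m j) := fun w => by
          rw [← Finset.mul_prod_erase _ _ hm, Function.update_self]
          congr 1
          exact Finset.prod_congr rfl fun j hj => by
            rw [Function.update_of_ne (Finset.ne_of_mem_erase hj)]
        rw [e, e, map_smul, smul_eq_mul, mul_assoc, mul_smul]
        simp only [Function.update_of_ne (Ne.symm hk)])

noncomputable def sxSlice (Mi : Fin n → ModN K 1) (i : Fin n)
    (l : ∀ j, (Mi j).carrier →ₗ[K] K) : (⨂[K] j, (Mi j).carrier) →ₗ[K] (Mi i).carrier :=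
  PiTensorProduct.lift (sxSliceM Mi i l)

lemma sxSlice_tprod (Mi : Fin n → ModN K 1) (i : Fin n)
    (l : ∀ j, (Mi j).carrier →ₗ[K] K) (m : ∀ j, (Mi j).carrier) :
    sxSlice Mi i l (PiTensorProduct.tprod K m)
      = (∏ j ∈ Finset.univ.erase i, l j (m j)) • m i := by
  rw [sxSlice, PiTensorProduct.lift.tprod]; rfl

lemma sxSlice_smul (Mi : Fin n → ModN K 1) (i : Fin n)
    (l : ∀ j, (Mi j).carrier →ₗ[K] K) (a : In K 1) (t : ⨂[K] j, (Mi j).carrier) :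
    sxSlice Mi i l (tprodMap K n Mi i a t) = a • sxSlice Mi i l t := by
  have : sxSlice Mi i l ∘ₗ tprodMap K n Mi i a
      = (Algebra.lsmul K K (Mi i).carrier a) ∘ₗ sxSlice Mi i l := by
    refine PiTensorProduct.ext ?_
    ext m
    change sxSlice Mi i l (tprodMap K n Mi i a (PiTensorProduct.tprod K m))
      = a • sxSlice Mi i l (PiTensorProduct.tprod K m)
    rw [sx_tprodMap, sxSlice_tprod, sxSlice_tprod, Function.update_self, ← smul_comm _ a]
    congr 1
    exact Finset.prod_congr rfl fun j hj => by
      rw [Function.update_of_ne (Finset.ne_of_mem_erase hj)]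
  exact LinearMap.congr_fun this t

lemma sxSlice_ne (Mi : Fin n → ModN K 1) (i : Fin n) (t : ⨂[K] j, (Mi j).carrier) (ht : t ≠ 0) :
    ∃ l, sxSlice Mi i l t ≠ 0 := by
  let b : ∀ j, Module.Basis _ K (Mi j).carrier := fun j => Module.Basis.ofVectorSpace K _
  let T := Basis.piTensorProduct b
  obtain ⟨κ, hκ⟩ : ∃ κ, T.repr t κ ≠ 0 := by
    by_contra! h
    exact ht (T.repr.map_eq_zero_iff.mp (Finsupp.ext h))
  refine ⟨fun j => (b j).coord (κ j), fun h => hκ ?_⟩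
  have : T.coord κ = (b i).coord (κ i) ∘ₗ sxSlice Mi i (fun j => (b j).coord (κ j)) := by
    refine PiTensorProduct.ext ?_
    ext m
    change T.repr (PiTensorProduct.tprod K m) κ = (b i).coord (κ i) (sxSlice Mi i _ (PiTensorProduct.tprod K m))
    rw [sxSlice_tprod, map_smul, Basis.piTensorProduct_repr_tprod_apply,
      ← Finset.prod_erase_mul _ _ (Finset.mem_univ i)]
    rfl
  have h2 := LinearMap.congr_fun this t
  rw [LinearMap.comp_apply, h, map_zero] at h2
  exact h2

variable {M' : Type*} [AddCommGroup M'] [Module K M'] [Module (In K n) M']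
  [IsScalarTower K (In K n) M']

theorem sx_part3 (Mi Mi' : Fin n → ModN K 1)
    (h1 : ∀ i, IsSimpleModule (In K 1) (Mi i).carrier)
    (h2 : ∀ i, IsSimpleModule (In K 1) (Mi' i).carrier)
    (hr : RealizesTensor K n Mi M) (hr' : RealizesTensor K n Mi' M') :
    (Nonempty (M ≃ₗ[In K n] M') ↔
        ∀ i, Nonempty ((Mi i).carrier ≃ₗ[In K 1] (Mi' i).carrier)) := by
  obtain ⟨φ, hφ⟩ := hr
  obtain ⟨φ', hφ'⟩ := hr'
  constructor
  · rintro ⟨f⟩ i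
    have hnt : ∀ j, ∃ u : (Mi j).carrier, u ≠ 0 := fun j =>
      have := IsSimpleModule.nontrivial (In K 1) (Mi j).carrier
      exists_ne 0
    choose u hu using hnt
    let F : (⨂[K] j, (Mi j).carrier) →ₗ[K] ⨂[K] j, (Mi' j).carrier :=
      φ'.toLinearMap ∘ₗ (f.toLinearMap.restrictScalars K) ∘ₗ φ.symm.toLinearMap
    have hFinj : Function.Injective F := by
      intro a b hab
      exact φ.symm.injective (f.injective (φ'.injective hab))
    have hFx : ∀ t, F (tprodMap K n Mi i (xEl K 1 0) t) = tprodMap K n Mi' i (xEl K 1 0) (F t) := by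
      intro t
      obtain ⟨m, rfl⟩ := φ.surjective t
      rw [← (hφ i m).1]
      simp only [F, LinearMap.comp_apply, LinearEquiv.coe_coe, LinearEquiv.symm_apply_apply,
        LinearMap.restrictScalars_apply, map_smul, (hφ' i _).1]
    have hFd : ∀ t, F (tprodMap K n Mi i (dEl K 1 0) t) = tprodMap K n Mi' i (dEl K 1 0) (F t) := by
      intro t
      obtain ⟨m, rfl⟩ := φ.surjective t
      rw [← (hφ i m).2.1]
      simp only [F, LinearMap.comp_apply, LinearEquiv.coe_coe, LinearEquiv.symm_apply_apply,
        LinearMap.restrictScalars_apply, map_smul, (hφ' i _).2.1]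
    have hFi : ∀ t, F (tprodMap K n Mi i (intEl K 1 0) t)
        = tprodMap K n Mi' i (intEl K 1 0) (F t) := by
      intro t
      obtain ⟨m, rfl⟩ := φ.surjective t
      rw [← (hφ i m).2.2]
      simp only [F, LinearMap.comp_apply, LinearEquiv.coe_coe, LinearEquiv.symm_apply_apply,
        LinearMap.restrictScalars_apply, map_smul, (hφ' i _).2.2]
    have hune : (PiTensorProduct.tprod K u : ⨂[K] j, (Mi j).carrier) ≠ 0 := by
      intro h0
      have hl : ∀ j, ∃ l : (Mi j).carrier →ₗ[K] K, l (u j) ≠ 0 := fun j =>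
        Module.Projective.exists_dual_ne_zero K (hu j)
      choose l hl using hl
      have h3 := sxSlice_tprod Mi i l u
      rw [h0, map_zero] at h3
      have h4 := smul_eq_zero.mp h3.symm
      rcases h4 with h4 | h4
      · exact (Finset.prod_ne_zero_iff.mpr fun j _ => hl j) h4
      · exact hu i h4
    obtain ⟨l, hl⟩ := sxSlice_ne Mi' i (F (PiTensorProduct.tprod K u))
      (fun h => hune (hFinj (by rw [h, map_zero])))
    let g : (Mi i).carrier →ₗ[K] (Mi' i).carrier :=
      sxSlice Mi' i l ∘ₗ F ∘ₗ (PiTensorProduct.tprod K).toLinearMap u i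
    have hga : ∀ a : In K 1, (∀ t, F (tprodMap K n Mi i a t) = tprodMap K n Mi' i a (F t)) →
        ∀ m, g (a • m) = a • g m := by
      intro a ha m
      have e : PiTensorProduct.tprod K (Function.update u i (a • m))
          = tprodMap K n Mi i a (PiTensorProduct.tprod K (Function.update u i m)) := by
        rw [sx_tprodMap, Function.update_self, Function.update_idem]
      simp only [g, LinearMap.comp_apply, MultilinearMap.toLinearMap_apply]
      rw [e, ha, sxSlice_smul]
    have hj0 : ∀ j : Fin 1, j = 0 := fun j => Subsingleton.elim j 0
    have hlin := sx_map_smul (n := 1) g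
      (fun j m => by rw [hj0 j]; exact hga _ hFx m)
      (fun j m => by rw [hj0 j]; exact hga _ hFd m)
      (fun j m => by rw [hj0 j]; exact hga _ hFi m)
    let G : (Mi i).carrier →ₗ[In K 1] (Mi' i).carrier :=
      { toFun := g, map_add' := g.map_add, map_smul' := hlin }
    have hG : G ≠ 0 := by
      intro h
      apply hl
      have := LinearMap.congr_fun h (u i)
      change sxSlice Mi' i l (F (PiTensorProduct.tprod K (Function.update u i (u i)))) = 0 at this
      rwa [Function.update_eq_self] at this
    have := h1 i
    have := h2 i
    exact ⟨LinearEquiv.ofBijective G ((LinearMap.bijective_or_eq_zero G).resolve_right hG)⟩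
  · intro h
    let e : ∀ i, (Mi i).carrier ≃ₗ[In K 1] (Mi' i).carrier := fun i => (h i).some
    let E : (⨂[K] j, (Mi j).carrier) ≃ₗ[K] ⨂[K] j, (Mi' j).carrier :=
      PiTensorProduct.congr (fun i => (e i).restrictScalars K)
    have hE : ∀ i a t, E (tprodMap K n Mi i a t) = tprodMap K n Mi' i a (E t) := by
      intro i a t
      have : E.toLinearMap ∘ₗ tprodMap K n Mi i a = tprodMap K n Mi' i a ∘ₗ E.toLinearMap := by
        refine PiTensorProduct.ext ?_
        ext m
        change E (tprodMap K n Mi i a (PiTensorProduct.tprod K m))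
          = tprodMap K n Mi' i a (E (PiTensorProduct.tprod K m))
        rw [sx_tprodMap]
        simp only [E, PiTensorProduct.congr_tprod]
        rw [sx_tprodMap]
        congr 1
        funext j
        by_cases h : j = i
        · subst h; simp
        · simp [h]
      exact LinearMap.congr_fun this t
    let g : M ≃ₗ[K] M' := φ.trans (E.trans φ'.symm)
    have hg : ∀ m, φ' (g m) = E (φ m) := fun m => by simp [g]
    have hlin := sx_map_smul (n := n) g.toLinearMap
      (fun i m => φ'.injective (by
        change φ' (g _) = φ' (_ • g m); rw [hg, (hφ i m).1, hE, (hφ' i _).1, hg]))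
      (fun i m => φ'.injective (by
        change φ' (g _) = φ' (_ • g m); rw [hg, (hφ i m).2.1, hE, (hφ' i _).2.1, hg]))
      (fun i m => φ'.injective (by
        change φ' (g _) = φ' (_ • g m); rw [hg, (hφ i m).2.2, hE, (hφ' i _).2.2, hg]))
    exact ⟨{ g with map_smul' := hlin }⟩

end Tensor
/-- simple generalized weight = simple weight `𝕀_n`-modules; each is a tensor
product of simple weight `𝕀_1`-modules, and two such tensor products are isomorphic iff all
their factors are isomorphic. -/
theorem statement4 (K : Type*) [Field K] [CharZero K] (n : ℕ) :
    (∀ (M : Type*) [AddCommGroup M] [Module K M] [Module (In K n) M] [IsScalarTower K (In K n) M],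
      IsSimpleModule (In K n) M → (IsGenWeightModule K n M ↔ IsWeightModule K n M)) ∧
    (∀ (M : Type*) [AddCommGroup M] [Module K M] [Module (In K n) M] [IsScalarTower K (In K n) M],
      IsSimpleModule (In K n) M → IsWeightModule K n M →
      ∃ Mi : Fin n → ModN K 1,
        (∀ i, IsSimpleModule (In K 1) (Mi i).carrier ∧ IsWeightModule K 1 (Mi i).carrier) ∧
        RealizesTensor K n Mi M) ∧
    (∀ (Mi Mi' : Fin n → ModN K 1) (M M' : Type*) [AddCommGroup M] [Module K M] [Module (In K n) M] [IsScalarTower K (In K n) M] [AddCommGroup M'] [Module K M'] [Module (In K n) M'] [IsScalarTower K (In K n) M'],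
      (∀ i, IsSimpleModule (In K 1) (Mi i).carrier ∧ IsWeightModule K 1 (Mi i).carrier) →
      (∀ i, IsSimpleModule (In K 1) (Mi' i).carrier ∧ IsWeightModule K 1 (Mi' i).carrier) →
      RealizesTensor K n Mi M → RealizesTensor K n Mi' M' →
      (Nonempty (M ≃ₗ[In K n] M') ↔
        ∀ i, Nonempty ((Mi i).carrier ≃ₗ[In K 1] (Mi' i).carrier))) := by
  refine ⟨?_, ?_, ?_⟩
  · intro M _ _ _ _ hM
    exact sx_part1 hM
  · intro M _ _ _ _ hM hw
    exact sx_part2 hM hw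
  · intro Mi Mi' M M' _ _ _ _ _ _ _ _ h1 h2 hr hr'
    exact sx_part3 Mi Mi' (fun i => (h1 i).1) (fun i => (h2 i).1) hr hr'

end IDO
end
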